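/- arXiv:1309.0720 — 3 statements merged into one kernel-verified Lean document; each statement's English description precedes it below -/
import Mathlib

section
/- For the map F_λ with λ ∈ (1/2,1), let φ : (0,1] → ℝ be a Hölder potential with lim_{x→0} φ(x) = a. Then dim_H(J_{φ,1}(a)) = 1. -/
open Set Filter MeasureTheory Topology

noncomputable section

/-- The Birkhoff sum `S_n φ (x) = ∑_{i<n} φ(Tⁱ x)`. -/
def birk (T φ : ℝ → ℝ) (n : ℕ) (x : ℝ) : ℝ :=
  ∑ i ∈ Finset.range n, φ (T^[i] x)

/-- The Markov partition of `(0,1]` for the map `F_λ`: `XF l 0 = (λ, 1)` is the paper's `X_1`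
and `XF l n = (λ^{n+1}, λ^n)` is the paper's `X_{n+1}`. -/
def XF (l : ℝ) (n : ℕ) : Set ℝ := Set.Ioo (l ^ (n + 1)) (l ^ n)

-- The map `F_λ`: `x ↦ (x-λ)/(1-λ)` on `X_1 = (λ,1)` and
-- `x ↦ (x-λⁿ)/(λ(1-λ))` on `X_n = (λⁿ, λ^{n-1})` for `n ≥ 2`.
open scoped Classical in
def Fmap (l : ℝ) (x : ℝ) : ℝ :=
  if x ∈ Set.Ioo l 1 then (x - l) / (1 - l)
  else if h : ∃ n : ℕ, x ∈ Set.Ioo (l ^ (n + 2)) (l ^ (n + 1)) then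
    (x - l ^ (Nat.find h + 2)) / (l * (1 - l))
  else 0

/-- The absolute value of the derivative of `F_λ`: `1/(1-λ)` on `X_1` and
`1/(λ(1-λ))` on `X_n`, `n ≥ 2`. -/
def Fabsd (l : ℝ) (x : ℝ) : ℝ :=
  if x ∈ Set.Ioo l 1 then 1 / (1 - l) else 1 / (l * (1 - l))

/-- The domain `⋃ n, X_n` of `F_λ`. -/
def FdomainSet (l : ℝ) : Set ℝ := ⋃ n, XF l n

/-- The repeller `X^∞` of `F_λ`: points whose whole forward orbit is defined. -/
def Frepeller (l : ℝ) : Set ℝ := {x | ∀ n : ℕ, (Fmap l)^[n] x ∈ FdomainSet l}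

/-- The recurrent set `X_R` of `F_λ`. -/
def FrecSet (l : ℝ) : Set ℝ :=
  {x ∈ Frepeller l | ∃ m : ℕ, ∀ N : ℕ, ∃ n ≥ N, (Fmap l)^[n] x ∈ XF l m}

/-- The escaping set `Ω_λ` of points converging to `0` under iteration of `F_λ`. -/
def Fescape (l : ℝ) : Set ℝ :=
  {x ∈ Frepeller l | Filter.Tendsto (fun n : ℕ => (Fmap l)^[n] x) Filter.atTop (nhds 0)}

/-- The level set `J_{φ,ψ}(α)` for quotients of Birkhoff averages of `F_λ`. -/
def FJset (l : ℝ) (φ ψ : ℝ → ℝ) (α : ℝ) : Set ℝ :=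
  {x ∈ Frepeller l |
    Filter.Tendsto (fun n => birk (Fmap l) φ n x / birk (Fmap l) ψ n x)
      Filter.atTop (nhds α)}

/-- The restricted level set `J_{R,φ,ψ}(α) = J_{φ,ψ}(α) ∩ X_R`. -/
def FJR (l : ℝ) (φ ψ : ℝ → ℝ) (α : ℝ) : Set ℝ := FJset l φ ψ α ∩ FrecSet l

/-- The set of values of limits of quotients of Birkhoff averages on the repeller of `F_λ`. -/
def FlimitSet (l : ℝ) (φ ψ : ℝ → ℝ) : Set ℝ :=
  {α | ∃ x ∈ Frepeller l,
    Filter.Tendsto (fun n => birk (Fmap l) φ n x / birk (Fmap l) ψ n x)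
      Filter.atTop (nhds α)}

/-- The Birkhoff level set `J_{φ,1}(α) = {x : lim_n S_nφ(x)/n = α}`. -/
def FJB (l : ℝ) (φ : ℝ → ℝ) (α : ℝ) : Set ℝ :=
  {x ∈ Frepeller l |
    Filter.Tendsto (fun n => birk (Fmap l) φ n x / n) Filter.atTop (nhds α)}

/-- The set of Birkhoff averages attained as limits on the repeller of `F_λ`. -/
def FlimB (l : ℝ) (φ : ℝ → ℝ) : Set ℝ :=
  {α | ∃ x ∈ Frepeller l,
    Filter.Tendsto (fun n => birk (Fmap l) φ n x / n) Filter.atTop (nhds α)}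

/-- The Lyapunov level set
`J(α) = {x ∈ X^∞ : lim_n (1/n) log|(F_λⁿ)'(x)| = α}`. -/
def FJL (l : ℝ) (α : ℝ) : Set ℝ :=
  {x ∈ Frepeller l |
    Filter.Tendsto (fun n => birk (Fmap l) (fun y => Real.log (Fabsd l y)) n x / n)
      Filter.atTop (nhds α)}

/-- `φ : (0,1] → ℝ` is a Hölder potential. -/
def HolderPotential (φ : ℝ → ℝ) : Prop :=
  ∃ C r : NNReal, 0 < r ∧ r ≤ 1 ∧ HolderOnWith C r φ (Set.Ioc 0 1)

/-- `F_λ`-invariant Borel probability measures supported on the repeller. -/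
def FInvMeasure (l : ℝ) (μ : Measure ℝ) : Prop :=
  IsProbabilityMeasure μ ∧ μ (Frepeller l) = 1 ∧
    ∀ A : Set ℝ, MeasurableSet A → μ (Fmap l ⁻¹' A) = μ A

/-- A finite measurable partition of `ℝ`, with parts `P 0, …, P (k-1)`. -/
def IsFinPart (k : ℕ) (P : ℕ → Set ℝ) : Prop :=
  (∀ i, MeasurableSet (P i)) ∧ (⋃ i ∈ Finset.range k, P i) = Set.univ ∧
    ∀ i j, i ≠ j → Disjoint (P i) (P j)

/-- The entropy `H_μ(⋁_{i<n} T^{-i} P)` of the `n`-th dynamical refinement of `P`. -/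
def dynEnt (T : ℝ → ℝ) (μ : Measure ℝ) (k : ℕ) (P : ℕ → Set ℝ) (n : ℕ) : ℝ :=
  ∑ f : Fin n → Fin k,
    Real.negMulLog (μ (⋂ i : Fin n, T^[(i : ℕ)] ⁻¹' P (f i))).toReal

/-- Measure-theoretic (Kolmogorov–Sinai) entropy `h(μ)`. -/
def entropy (T : ℝ → ℝ) (μ : Measure ℝ) : ℝ :=
  sSup {h | ∃ k : ℕ, ∃ P : ℕ → Set ℝ, IsFinPart k P ∧
    h = Filter.limsup (fun n => dynEnt T μ k P n / n) Filter.atTop}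

/-- The Lyapunov exponent `λ_{F_λ}(μ) = ∫ log|F_λ'| dμ`. -/
def FlyapExp (l : ℝ) (μ : Measure ℝ) : ℝ := ∫ x, Real.log (Fabsd l x) ∂μ

/-- The one-sided shift on sequences. -/
def shiftMap (x : ℕ → ℕ) : ℕ → ℕ := fun i => x (i + 1)

/-- The shift space determined by a transition matrix `t` over the alphabet `ℕ`. -/
def shiftSpace (t : ℕ → ℕ → Prop) : Set (ℕ → ℕ) := {x | ∀ i, t (x i) (x (i + 1))}

/-- Topological mixing of a countable Markov shift relative to a set `A` of symbols. -/
def TopMixingOn (t : ℕ → ℕ → Prop) (A : Set ℕ) : Prop :=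
  ∀ a ∈ A, ∀ b ∈ A, ∃ N : ℕ, ∀ n ≥ N, n ≥ 1 → ∃ x ∈ shiftSpace t, x 0 = a ∧ x n = b

/-- A function on the shift space is locally Hölder: `var_n(g) ≤ C γⁿ` for all `n ≥ 1`. -/
def LocallyHolderOn (t : ℕ → ℕ → Prop) (g : (ℕ → ℕ) → ℝ) : Prop :=
  ∃ C > (0 : ℝ), ∃ γ ∈ Set.Ioo (0 : ℝ) 1, ∀ n : ℕ, 1 ≤ n →
    ∀ x ∈ shiftSpace t, ∀ y ∈ shiftSpace t,
      (∀ i < n, x i = y i) → |g x - g y| ≤ C * γ ^ n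

/-- A topologically mixing countable Markov coding `emb : Σ → X^∞` for `F_λ`. -/
def FCoding (l : ℝ) (t : ℕ → ℕ → Prop) (emb : (ℕ → ℕ) → ℝ) : Prop :=
  TopMixingOn t Set.univ ∧
  ContinuousOn emb (shiftSpace t) ∧
  Set.InjOn emb (shiftSpace t) ∧
  emb '' shiftSpace t = Frepeller l ∧
  (∀ x ∈ shiftSpace t, Fmap l (emb x) = emb (shiftMap x)) ∧
  (∀ x ∈ shiftSpace t, emb x ∈ XF l (x 0))

theorem XF_index_unique {l : ℝ} (h0 : 0 < l) (h1 : l < 1) {m n : ℕ} {x : ℝ}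
    (hx : x ∈ XF l m) (hy : x ∈ XF l n) : m = n := by
  have key : ∀ i j : ℕ, x ∈ XF l i → x ∈ XF l j → i ≤ j := by
    intro i j hi hj
    by_contra! hlt
    have : l ^ i ≤ l ^ (j + 1) := pow_le_pow_of_le_one h0.le h1.le hlt
    have h2 := hi.2
    have h3 := hj.1
    linarith
  exact le_antisymm (key m n hx hy) (key n m hy hx)

theorem Fmap_eq_of_mem_XF_zero {l x : ℝ} (hx : x ∈ XF l 0) :
    Fmap l x = (x - l) / (1 - l) := by
  have : x ∈ Ioo l 1 := by simpa [XF] using hx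
  simp only [Fmap, if_pos this]

theorem Fmap_eq_of_mem_XF_succ {l x : ℝ} (h0 : 0 < l) (h1 : l < 1) {n : ℕ}
    (hx : x ∈ XF l (n + 1)) : Fmap l x = (x - l ^ (n + 2)) / (l * (1 - l)) := by
  classical
  have hn : x ∉ Ioo l 1 := by
    intro h
    have : x ∈ XF l 0 := by simpa [XF] using h
    exact absurd (XF_index_unique h0 h1 this hx) (by omega)
  have hex : ∃ k : ℕ, x ∈ Ioo (l ^ (k + 2)) (l ^ (k + 1)) := ⟨n, hx⟩
  have hfind : Nat.find hex = n := by
    have h2 : x ∈ XF l (Nat.find hex + 1) := Nat.find_spec hex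
    have := XF_index_unique h0 h1 h2 hx
    omega
  rw [Fmap, if_neg hn, dif_pos hex, hfind]

theorem Fmap_eq_zero_of_notMem {l x : ℝ} (hx : x ∉ FdomainSet l) : Fmap l x = 0 := by
  simp only [FdomainSet, mem_iUnion, not_exists] at hx
  have hn : x ∉ Ioo l 1 := fun h => hx 0 (by simpa [XF] using h)
  have hex : ¬ ∃ k : ℕ, x ∈ Ioo (l ^ (k + 2)) (l ^ (k + 1)) := fun ⟨k, hk⟩ => hx (k + 1) hk
  rw [Fmap, if_neg hn, dif_neg hex]

theorem measurableSet_FdomainSet (l : ℝ) : MeasurableSet (FdomainSet l) :=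
  MeasurableSet.iUnion fun _ => measurableSet_Ioo

theorem FdomainSet_subset_Ioo {l : ℝ} (h0 : 0 < l) (h1 : l < 1) : FdomainSet l ⊆ Ioo 0 1 := by
  intro x hx
  obtain ⟨n, hn⟩ := mem_iUnion.1 hx
  exact ⟨(pow_pos h0 _).trans hn.1, hn.2.trans_le (pow_le_one₀ h0.le h1.le)⟩

theorem measurable_Fmap {l : ℝ} (h0 : 0 < l) (h1 : l < 1) : Measurable (Fmap l) := by
  have hg : ∀ n : ℕ, ∃ g : ℝ → ℝ, Measurable g ∧ EqOn (Fmap l) g (XF l n) := by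
    rintro (_ | n)
    · exact ⟨fun x => (x - l) / (1 - l), by fun_prop, fun x hx => Fmap_eq_of_mem_XF_zero hx⟩
    · exact ⟨fun x => (x - l ^ (n + 2)) / (l * (1 - l)), by fun_prop,
        fun x hx => Fmap_eq_of_mem_XF_succ h0 h1 hx⟩
  choose g hgm hgeq using hg
  intro A hA
  have hpre : Fmap l ⁻¹' A =
      (⋃ n, XF l n ∩ g n ⁻¹' A) ∪ ((FdomainSet l)ᶜ ∩ (fun _ : ℝ => (0 : ℝ)) ⁻¹' A) := by
    ext x
    by_cases hx : x ∈ FdomainSet l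
    · simp only [mem_preimage, mem_union, mem_iUnion, mem_inter_iff, mem_compl_iff, hx,
        not_true_eq_false, false_and, or_false]
      constructor
      · intro h
        obtain ⟨n, hn⟩ := mem_iUnion.1 hx
        exact ⟨n, hn, by rwa [← hgeq n hn]⟩
      · rintro ⟨n, hn, h⟩
        rwa [hgeq n hn]
    · have hn : ∀ n, x ∉ XF l n := fun n h => hx (mem_iUnion.2 ⟨n, h⟩)
      simp [hx, hn, Fmap_eq_zero_of_notMem hx]
  rw [hpre]
  exact (MeasurableSet.iUnion fun n => measurableSet_Ioo.inter (hgm n hA)).union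
    ((measurableSet_FdomainSet l).compl.inter (measurable_const hA))

/-- Integrals over `(0, λ^M)` are bounded by sums over the Markov partition. -/
theorem setLIntegral_Ioo_pow_le_tsum {l : ℝ} (h0 : 0 < l) (h1 : l < 1) (M : ℕ)
    (g : ℝ → ENNReal) :
    ∫⁻ x in Ioo 0 (l ^ M), g x ≤ ∑' m, ∫⁻ x in XF l (M + m), g x := by
  have hsub : Ioo 0 (l ^ M) ⊆ (⋃ m, XF l (M + m)) ∪ range (fun m : ℕ => l ^ m) := by
    intro x hx
    by_cases hr : x ∈ range (fun m : ℕ => l ^ m)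
    · exact Or.inr hr
    left
    obtain ⟨n, hn1, hn2⟩ := exists_nat_pow_near_of_lt_one hx.1
      (hx.2.le.trans (pow_le_one₀ h0.le h1.le)) h0 h1
    have hne : x ≠ l ^ n := fun h => hr ⟨n, h.symm⟩
    have hMn : M ≤ n := by
      by_contra! hlt
      have : l ^ M ≤ l ^ (n + 1) := pow_le_pow_of_le_one h0.le h1.le hlt
      linarith [hx.2]
    obtain ⟨k, rfl⟩ := Nat.exists_eq_add_of_le hMn
    exact mem_iUnion.2 ⟨k, hn1, lt_of_le_of_ne hn2 hne⟩
  have hnull : volume (range (fun m : ℕ => l ^ m)) = 0 := (countable_range _).measure_zero _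
  calc ∫⁻ x in Ioo 0 (l ^ M), g x
      ≤ ∫⁻ x in (⋃ m, XF l (M + m)) ∪ range (fun m : ℕ => l ^ m), g x :=
        lintegral_mono_set hsub
    _ ≤ (∫⁻ x in ⋃ m, XF l (M + m), g x) + ∫⁻ x in range (fun m : ℕ => l ^ m), g x :=
        lintegral_union_le _ _ _
    _ = ∫⁻ x in ⋃ m, XF l (M + m), g x := by rw [setLIntegral_measure_zero _ _ hnull, add_zero]
    _ ≤ _ := lintegral_iUnion_le _ _

theorem setLIntegral_comp_affine {b c e : ℝ} (hc : 0 < c) (g : ℝ → ENNReal) :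
    ∫⁻ x in Ioo b (b + c * e), g ((x - b) / c) = ENNReal.ofReal c * ∫⁻ y in Ioo 0 e, g y := by
  have himg : (fun y => c * y + b) '' Ioo 0 e = Ioo b (b + c * e) := by
    rw [image_affine_Ioo hc, mul_zero, zero_add, add_comm b]
  have hder : ∀ y ∈ Ioo 0 e, HasDerivWithinAt (fun y => c * y + b) c (Ioo 0 e) y := by
    intro y _
    simpa using (((hasDerivAt_id y).const_mul c).add_const b).hasDerivWithinAt
  have hinj : InjOn (fun y => c * y + b) (Ioo 0 e) := by
    intro y _ z _ h
    have : c * y = c * z := by simpa using h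
    exact mul_left_cancel₀ hc.ne' this
  rw [← himg, lintegral_image_eq_lintegral_abs_deriv_mul measurableSet_Ioo hder hinj,
    ← lintegral_const_mul' _ _ ENNReal.ofReal_ne_top, abs_of_pos hc]
  congr with y
  rw [add_sub_cancel_right, mul_div_cancel_left₀ _ hc.ne']

/-- If the integrals of `V` over `XF l N` are at most `(1 - λ) 2⁻ᴺ`, then the integrals of `V ∘ F_λⁿ` decay exponentially in `n`. -/
theorem setLIntegral_iterate_Fmap_le {l : ℝ} (hl : l ∈ Ioo (1 / 2 : ℝ) 1) {V : ℝ → ENNReal}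
    (hV : ∀ N, ∫⁻ x in XF l N, V x ≤ ENNReal.ofReal ((1 - l) * (1 / 2) ^ N)) (n N : ℕ) :
    ∫⁻ x in XF l N, V ((Fmap l)^[n] x) ≤
      ENNReal.ofReal ((1 - l) * (1 / 2) ^ N * (4 * l * (1 - l)) ^ n) := by
  obtain ⟨hl2, h1⟩ := hl
  have h0 : 0 < l := by linarith
  have h1' : 0 < 1 - l := by linarith
  have hρ : 0 < 4 * l * (1 - l) := by positivity
  induction n generalizing N with
  | zero => simpa using hV N
  | succ n ih =>
    have hsum : ∀ M : ℕ, ∫⁻ y in Ioo 0 (l ^ M), V ((Fmap l)^[n] y) ≤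
        ENNReal.ofReal ((1 - l) * (4 * l * (1 - l)) ^ n * ((1 / 2) ^ M * 2)) := by
      intro M
      have hs : HasSum (fun m : ℕ => (1 - l) * (1 / 2) ^ (M + m) * (4 * l * (1 - l)) ^ n)
          ((1 - l) * (4 * l * (1 - l)) ^ n * ((1 / 2) ^ M * 2)) := by
        have := (hasSum_geometric_two.mul_left ((1 / 2 : ℝ) ^ M)).mul_left
          ((1 - l) * (4 * l * (1 - l)) ^ n)
        have hfun : (fun m : ℕ => (1 - l) * (1 / 2) ^ (M + m) * (4 * l * (1 - l)) ^ n) =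
            fun m => (1 - l) * (4 * l * (1 - l)) ^ n * ((1 / 2) ^ M * (1 / 2) ^ m) := by
          ext m; ring
        rwa [hfun]
      calc _ ≤ _ := setLIntegral_Ioo_pow_le_tsum h0 h1 M _
        _ ≤ ∑' m : ℕ, ENNReal.ofReal ((1 - l) * (1 / 2) ^ (M + m) * (4 * l * (1 - l)) ^ n) :=
          ENNReal.tsum_le_tsum fun m => ih (M + m)
        _ = _ := by
          rw [← ENNReal.ofReal_tsum_of_nonneg (fun m => by positivity) hs.summable, hs.tsum_eq]
    have hpn : 0 < (4 * l * (1 - l)) ^ n := by positivity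
    rcases N with _ | M
    · have hX : XF l 0 = Ioo l (l + (1 - l) * l ^ 0) := by simp [XF]
      have heq : ∫⁻ x in XF l 0, V ((Fmap l)^[n + 1] x) =
          ∫⁻ x in XF l 0, V ((Fmap l)^[n] ((x - l) / (1 - l))) :=
        setLIntegral_congr_fun measurableSet_Ioo fun x hx => by
          simp only [Function.iterate_succ_apply, Fmap_eq_of_mem_XF_zero hx]
      rw [heq, hX, setLIntegral_comp_affine h1' (fun y => V ((Fmap l)^[n] y))]
      refine (mul_le_mul_right (hsum 0) _).trans ?_
      rw [← ENNReal.ofReal_mul h1'.le]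
      apply ENNReal.ofReal_le_ofReal
      rw [pow_succ]
      have : 0 ≤ (1 - l) ^ 2 * (4 * l * (1 - l)) ^ n * (4 * l - 2) :=
        mul_nonneg (by positivity) (by linarith)
      nlinarith
    · have hX : XF l (M + 1) = Ioo (l ^ (M + 2)) (l ^ (M + 2) + l * (1 - l) * l ^ M) := by
        rw [XF]; congr 1; ring
      have heq : ∫⁻ x in XF l (M + 1), V ((Fmap l)^[n + 1] x) =
          ∫⁻ x in XF l (M + 1), V ((Fmap l)^[n] ((x - l ^ (M + 2)) / (l * (1 - l)))) :=
        setLIntegral_congr_fun measurableSet_Ioo fun x hx => by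
          simp only [Function.iterate_succ_apply, Fmap_eq_of_mem_XF_succ h0 h1 hx]
      rw [heq, hX, setLIntegral_comp_affine (by positivity) (fun y => V ((Fmap l)^[n] y))]
      refine (mul_le_mul_right (hsum M) _).trans ?_
      rw [← ENNReal.ofReal_mul (by positivity)]
      apply ENNReal.ofReal_le_ofReal
      apply le_of_eq
      ring

/-- Lebesgue almost every point of `(λ, 1)` escapes to `0` under `F_λ` if `λ > 1/2`. -/
theorem ae_mem_Fescape {l : ℝ} (hl : l ∈ Ioo (1 / 2 : ℝ) 1) :
    ∀ᵐ x ∂(volume.restrict (XF l 0)), x ∈ Fescape l := by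
  classical
  have hl2 := hl.1
  have h1 := hl.2
  have h0 : 0 < l := by linarith
  have h1' : 0 < 1 - l := by linarith
  set t : ℝ := Real.log (1 / (2 * l)) / Real.log l with ht
  have hlog : Real.log l < 0 := Real.log_neg h0 h1
  have htpos : 0 < t := by
    apply div_pos_of_neg_of_neg _ hlog
    exact Real.log_neg (by positivity) (by rw [div_lt_one (by positivity)]; linarith)
  have hlt : l ^ t = 1 / (2 * l) := by
    rw [Real.rpow_def_of_pos h0, ht, mul_div_cancel₀ _ hlog.ne, Real.exp_log (by positivity)]
  set V : ℝ → ENNReal := fun x => if x ∈ FdomainSet l then ENNReal.ofReal (x ^ t) else ⊤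
    with hVdef
  have hVm : Measurable V :=
    Measurable.ite (measurableSet_FdomainSet l) (by fun_prop) measurable_const
  have hV : ∀ N, ∫⁻ x in XF l N, V x ≤ ENNReal.ofReal ((1 - l) * (1 / 2) ^ N) := by
    intro N
    have hle : ∀ x ∈ XF l N, V x ≤ ENNReal.ofReal ((1 / (2 * l)) ^ N) := by
      intro x hx
      have hD : x ∈ FdomainSet l := mem_iUnion.2 ⟨N, hx⟩
      simp only [hVdef, if_pos hD]
      apply ENNReal.ofReal_le_ofReal
      rw [← hlt, ← Real.rpow_natCast, ← Real.rpow_mul h0.le, mul_comm, Real.rpow_mul h0.le,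
        Real.rpow_natCast]
      exact Real.rpow_le_rpow ((FdomainSet_subset_Ioo h0 h1 hD).1.le) hx.2.le htpos.le
    calc _ ≤ ∫⁻ _ in XF l N, ENNReal.ofReal ((1 / (2 * l)) ^ N) :=
          setLIntegral_mono measurable_const hle
      _ = ENNReal.ofReal ((1 - l) * (1 / 2) ^ N) := by
          rw [setLIntegral_const, XF, Real.volume_Ioo, ← ENNReal.ofReal_mul (by positivity)]
          congr 1
          have : (1 / 2 : ℝ) ^ N = (1 / (2 * l)) ^ N * l ^ N := by
            rw [← mul_pow]; congr 1; field_simp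
          rw [this]; ring
  have hFm : ∀ n, Measurable fun x => V ((Fmap l)^[n] x) := fun n =>
    hVm.comp ((measurable_Fmap h0 h1).iterate n)
  have hρ0 : 0 ≤ 4 * l * (1 - l) := by positivity
  have hρ1 : 4 * l * (1 - l) < 1 := by nlinarith [sq_pos_of_pos (by linarith : 0 < 2 * l - 1)]
  have hfin : ∫⁻ x in XF l 0, ∑' n, V ((Fmap l)^[n] x) ≠ ⊤ := by
    rw [lintegral_tsum fun n => (hFm n).aemeasurable]
    refine ne_top_of_le_ne_top ?_
      (ENNReal.tsum_le_tsum fun n => setLIntegral_iterate_Fmap_le hl hV n 0)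
    rw [← ENNReal.ofReal_tsum_of_nonneg (fun n => by positivity)
      ((summable_geometric_of_lt_one hρ0 hρ1).mul_left _)]
    exact ENNReal.ofReal_ne_top
  filter_upwards [ae_lt_top (Measurable.tsum hFm) hfin] with x hx
  have hD : ∀ n, (Fmap l)^[n] x ∈ FdomainSet l := by
    intro n
    by_contra hn
    have := ENNReal.ne_top_of_tsum_ne_top hx.ne n
    simp [hVdef, hn] at this
  refine ⟨hD, ?_⟩
  have hlim := ENNReal.tendsto_atTop_zero_of_tsum_ne_top hx.ne
  have hVeq : ∀ n, V ((Fmap l)^[n] x) = ENNReal.ofReal (((Fmap l)^[n] x) ^ t) := fun n => by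
    simp only [hVdef, if_pos (hD n)]
  have hpos : ∀ n, 0 ≤ (Fmap l)^[n] x := fun n => (FdomainSet_subset_Ioo h0 h1 (hD n)).1.le
  have hreal : Tendsto (fun n => ((Fmap l)^[n] x) ^ t) atTop (𝓝 0) := by
    have := (ENNReal.tendsto_toReal ENNReal.zero_ne_top).comp hlim
    refine this.congr fun n => ?_
    simp only [Function.comp, hVeq n]
    exact ENNReal.toReal_ofReal (Real.rpow_nonneg (hpos n) _)
  have hroot := hreal.rpow_const (p := t⁻¹) (Or.inr (inv_nonneg.2 htpos.le))
  rw [Real.zero_rpow (inv_ne_zero htpos.ne')] at hroot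
  exact hroot.congr fun n => Real.rpow_rpow_inv (hpos n) htpos.ne'

theorem Fescape_subset_FJB {l : ℝ} (h0 : 0 < l) (h1 : l < 1) {φ : ℝ → ℝ} {a : ℝ}
    (ha : Tendsto φ (𝓝[Ioc 0 1] 0) (𝓝 a)) : Fescape l ⊆ FJB l φ a := by
  rintro x ⟨hx, hlim⟩
  refine ⟨hx, ?_⟩
  have hw : Tendsto (fun n : ℕ => (Fmap l)^[n] x) atTop (𝓝[Ioc 0 1] 0) :=
    tendsto_nhdsWithin_iff.2 ⟨hlim, Eventually.of_forall fun n =>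
      Ioo_subset_Ioc_self (FdomainSet_subset_Ioo h0 h1 (hx n))⟩
  refine (ha.comp hw).cesaro.congr fun n => ?_
  rw [birk, div_eq_inv_mul]
  rfl

/-- **Theorem.** For `λ ∈ (1/2, 1)` and a Hölder potential `φ : (0,1] → ℝ` with
`lim_{x→0} φ(x) = a`, the Birkhoff level set at `a` has full dimension:
`dim_H J_{φ,1}(a) = 1`. -/
theorem F_dimH_level_set_at_limit_eq_one
    (l : ℝ) (hl : l ∈ Set.Ioo (1 / 2 : ℝ) 1)
    (φ : ℝ → ℝ) (hφ : HolderPotential φ)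
    (a : ℝ) (ha : Filter.Tendsto φ (nhdsWithin 0 (Set.Ioc (0 : ℝ) 1)) (nhds a)) :
    dimH (FJB l φ a) = 1 := by
  have h0 : 0 < l := by linarith [hl.1]
  apply le_antisymm
  · exact (dimH_mono (subset_univ _)).trans Real.dimH_univ.le
  · have hne : Measure.hausdorffMeasure ((1 : NNReal) : ℝ) (FJB l φ a) ≠ 0 := by
      rw [NNReal.coe_one, hausdorffMeasure_real]
      intro hzero
      have hle : volume (XF l 0) ≤ volume (FJB l φ a) := by
        apply measure_mono_ae
        have := (ae_restrict_iff' (measurableSet_Ioo : MeasurableSet (XF l 0))).1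
          (ae_mem_Fescape hl)
        filter_upwards [this] with x hx hmem
        exact Fescape_subset_FJB h0 hl.2 ha (hx hmem)
      rw [hzero, XF, Real.volume_Ioo, nonpos_iff_eq_zero, ENNReal.ofReal_eq_zero] at hle
      have := hl.2
      simp only [zero_add, pow_one, pow_zero] at hle
      linarith
    simpa using le_dimH_of_hausdorffMeasure_ne_zero hne

end
end

section
/- For the map F_λ with λ ∈ (1/2,1) and for every t > −log 2 / log λ, setting α_t := −log(1−λ) − (λᵗ log λ)/(1−λᵗ), the Lyapunov level set satisfies dim_H(J(α_t)) = ( t log(1−λ) − log(1−λᵗ) ) / α_t + t. -/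
open Set Filter MeasureTheory Topology

noncomputable section

namespace LurothCoding

/-- The sum of the first `n` digits. -/
def digitSum (w : ℕ → ℕ) (n : ℕ) : ℕ := ∑ i ∈ Finset.range n, w i

/-- The length of the `n`-th cylinder of the digit sequence `w`: the digit `j` selects the
subinterval `(l ^ (j + 1), l ^ j]` of `(0, 1]`. -/
def cylLen (l : ℝ) (w : ℕ → ℕ) (n : ℕ) : ℝ := ∏ i ∈ Finset.range n, (1 - l) * l ^ w i

/-- The left endpoint of the `n`-th cylinder of `w`. -/
def cylLeft (l : ℝ) (w : ℕ → ℕ) (n : ℕ) : ℝ :=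
  ∑ i ∈ Finset.range n, cylLen l w i * l ^ (w i + 1)

/-- The point of `(0, 1]` coded by `w`. -/
def codePt (l : ℝ) (w : ℕ → ℕ) : ℝ := ∑' i, cylLen l w i * l ^ (w i + 1)

variable {l : ℝ} {w v : ℕ → ℕ} {n : ℕ}

lemma digitSum_succ (w : ℕ → ℕ) (n : ℕ) : digitSum w (n + 1) = digitSum w n + w n :=
  Finset.sum_range_succ _ _

lemma cylLen_zero : cylLen l w 0 = 1 := by simp [cylLen]

lemma cylLen_succ : cylLen l w (n + 1) = cylLen l w n * ((1 - l) * l ^ w n) :=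
  Finset.prod_range_succ _ _

lemma cylLeft_zero : cylLeft l w 0 = 0 := by simp [cylLeft]

lemma cylLeft_succ : cylLeft l w (n + 1) = cylLeft l w n + cylLen l w n * l ^ (w n + 1) :=
  Finset.sum_range_succ _ _

lemma cylLen_eq : cylLen l w n = (1 - l) ^ n * l ^ digitSum w n := by
  simp [cylLen, digitSum, Finset.prod_mul_distrib, Finset.prod_pow_eq_pow_sum]

lemma cylLen_pos (hl : l ∈ Ioo (0 : ℝ) 1) : 0 < cylLen l w n := by
  have h1 := hl.1
  have h2 : 0 < 1 - l := by linarith [hl.2]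
  rw [cylLen_eq]; positivity

lemma cylLen_le (hl : l ∈ Ioo (0 : ℝ) 1) : cylLen l w n ≤ (1 - l) ^ n := by
  have h2 : 0 < 1 - l := by linarith [hl.2]
  rw [cylLen_eq]
  exact mul_le_of_le_one_right (by positivity) (pow_le_one₀ hl.1.le hl.2.le)

lemma cylLen_congr (h : ∀ i < n, w i = v i) : cylLen l w n = cylLen l v n :=
  Finset.prod_congr rfl fun i hi => by rw [h i (Finset.mem_range.1 hi)]

lemma cylLeft_congr (h : ∀ i < n, w i = v i) : cylLeft l w n = cylLeft l v n :=
  Finset.sum_congr rfl fun i hi => by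
    have hi := Finset.mem_range.1 hi
    rw [h i hi, cylLen_congr fun k hk => h k (hk.trans hi)]

lemma cylLen_add (k : ℕ) :
    cylLen l w (n + k) = cylLen l w n * cylLen l (fun i => w (n + i)) k :=
  Finset.prod_range_add _ _ _

lemma cylRight_succ :
    cylLeft l w (n + 1) + cylLen l w (n + 1) = cylLeft l w n + cylLen l w n * l ^ w n := by
  rw [cylLeft_succ, cylLen_succ]; ring

lemma cylRight_succ_le (hl : l ∈ Ioo (0 : ℝ) 1) :
    cylLeft l w (n + 1) + cylLen l w (n + 1) ≤ cylLeft l w n + cylLen l w n := by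
  rw [cylRight_succ]
  have := mul_le_of_le_one_right (cylLen_pos hl (w := w) (n := n)).le
    (pow_le_one₀ (n := w n) hl.1.le hl.2.le)
  linarith

lemma cylRight_le_one (hl : l ∈ Ioo (0 : ℝ) 1) : cylLeft l w n + cylLen l w n ≤ 1 := by
  induction n with
  | zero => simp [cylLeft_zero, cylLen_zero]
  | succ n ih => exact (cylRight_succ_le hl).trans ih

lemma term_pos (hl : l ∈ Ioo (0 : ℝ) 1) (i : ℕ) : 0 < cylLen l w i * l ^ (w i + 1) :=
  mul_pos (cylLen_pos hl) (pow_pos hl.1 _)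

lemma cylLeft_le_one (hl : l ∈ Ioo (0 : ℝ) 1) : cylLeft l w n ≤ 1 := by
  linarith [cylRight_le_one hl (w := w) (n := n), cylLen_pos hl (w := w) (n := n)]

lemma summable_code (hl : l ∈ Ioo (0 : ℝ) 1) (w : ℕ → ℕ) :
    Summable fun i => cylLen l w i * l ^ (w i + 1) :=
  summable_of_sum_range_le (fun i => (term_pos hl i).le) fun _ => cylLeft_le_one hl

lemma codePt_mem (hl : l ∈ Ioo (0 : ℝ) 1) (w : ℕ → ℕ) : codePt l w ∈ Ioc (0 : ℝ) 1 :=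
  ⟨(summable_code hl w).tsum_pos (fun i => (term_pos hl i).le) 0 (term_pos hl 0),
    Real.tsum_le_of_sum_range_le (fun i => (term_pos hl i).le) fun _ => cylLeft_le_one hl⟩

lemma codePt_eq (hl : l ∈ Ioo (0 : ℝ) 1) (w : ℕ → ℕ) (n : ℕ) :
    codePt l w = cylLeft l w n + cylLen l w n * codePt l (fun i => w (n + i)) := by
  rw [codePt, ← (summable_code hl w).sum_add_tsum_nat_add n, codePt, ← tsum_mul_left]
  congr 1
  refine tsum_congr fun i => ?_
  rw [add_comm i n, cylLen_add, mul_assoc]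

lemma codePt_mem_cyl (hl : l ∈ Ioo (0 : ℝ) 1) (w : ℕ → ℕ) (n : ℕ) :
    codePt l w ∈ Ioc (cylLeft l w n) (cylLeft l w n + cylLen l w n) := by
  have h := codePt_mem hl (fun i => w (n + i))
  have h0 := cylLen_pos hl (w := w) (n := n)
  rw [codePt_eq hl w n]
  constructor
  · linarith [mul_pos h0 h.1]
  · linarith [mul_le_of_le_one_right h0.le h.2]

lemma codePt_eq_one_step (hl : l ∈ Ioo (0 : ℝ) 1) (w : ℕ → ℕ) :
    codePt l w = l ^ (w 0 + 1) + (1 - l) * l ^ w 0 * codePt l (fun i => w (1 + i)) := by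
  rw [codePt_eq hl w 1]
  simp [cylLeft, cylLen]

lemma codePt_digit (hl : l ∈ Ioo (0 : ℝ) 1) (w : ℕ → ℕ) :
    codePt l w ∈ Ioc (l ^ (w 0 + 1)) (l ^ w 0) := by
  have := codePt_mem_cyl hl w 1
  rwa [cylRight_succ, cylLeft_succ, cylLeft_zero, cylLen_zero, zero_add, one_mul, zero_add,
    one_mul] at this

lemma codePt_eq_one (hl : l ∈ Ioo (0 : ℝ) 1) (n : ℕ) (h : codePt l w = 1) : w n = 0 := by
  have key : ∀ {w : ℕ → ℕ}, codePt l w = 1 → w 0 = 0 ∧ codePt l (fun i => w (1 + i)) = 1 := by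
    intro w h
    have h0 : w 0 = 0 := by
      by_contra h0
      have := (codePt_digit hl w).2
      rw [h] at this
      exact (pow_lt_one₀ hl.1.le hl.2 h0).not_ge this
    refine ⟨h0, ?_⟩
    have := codePt_eq_one_step hl w
    rw [h, h0, zero_add, pow_one, pow_zero, mul_one] at this
    have h2 : 0 < 1 - l := by linarith [hl.2]
    have h3 : (1 - l) * (codePt l (fun i => w (1 + i)) - 1) = 0 := by linarith
    rcases mul_eq_zero.1 h3 with h | h <;> linarith
  induction n generalizing w with
  | zero => exact (key h).1
  | succ n ih => rw [add_comm n 1]; exact ih (key h).2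

lemma exists_digit (hl : l ∈ Ioo (0 : ℝ) 1) {y : ℝ} (hy : y ∈ Ioc (0 : ℝ) 1) :
    ∃ j : ℕ, y ∈ Ioc (l ^ (j + 1)) (l ^ j) := by
  obtain ⟨n, hn⟩ := exists_nat_pow_near_of_lt_one hy.1 hy.2 hl.1 hl.2
  exact ⟨n, hn⟩

lemma exists_codePt_eq (hl : l ∈ Ioo (0 : ℝ) 1) {y : ℝ} (hy : y ∈ Ioc (0 : ℝ) 1) :
    ∃ w, codePt l w = y := by
  have h2 : 0 < 1 - l := by linarith [hl.2]
  choose! d hd using fun y => exists_digit hl (y := y)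
  let T : ℝ → ℝ := fun y => (y / l ^ d y - l) / (1 - l)
  have hT : ∀ y ∈ Ioc (0 : ℝ) 1, T y ∈ Ioc (0 : ℝ) 1 := by
    intro y hy
    have hp := pow_pos hl.1 (d y)
    have h := hd y hy
    have e1 : l < y / l ^ d y := by rw [lt_div_iff₀ hp, ← pow_succ']; exact h.1
    have e2 : y / l ^ d y ≤ 1 := by rw [div_le_one hp]; exact h.2
    exact ⟨div_pos (by linarith) h2, (div_le_one h2).2 (by linarith)⟩
  have hTn : ∀ n, T^[n] y ∈ Ioc (0 : ℝ) 1 := by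
    intro n
    induction n with
    | zero => exact hy
    | succ n ih => rw [Function.iterate_succ_apply']; exact hT _ ih
  let w : ℕ → ℕ := fun n => d (T^[n] y)
  have key : ∀ n, y = cylLeft l w n + cylLen l w n * T^[n] y := by
    intro n
    induction n with
    | zero => simp [cylLeft_zero, cylLen_zero]
    | succ n ih =>
      rw [cylLeft_succ, cylLen_succ, Function.iterate_succ_apply']
      have hz : ∀ z, z = l ^ (d z + 1) + (1 - l) * l ^ d z * T z := by
        intro z
        have hp := (pow_pos hl.1 (d z)).ne'
        simp only [T]
        field_simp
        ring
      have : T^[n] y = l ^ (w n + 1) + (1 - l) * l ^ w n * T (T^[n] y) := hz _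
      nth_rw 1 [ih]
      nth_rw 1 [this]
      ring
  refine ⟨w, ?_⟩
  have hlim : Tendsto (fun n => (1 - l) ^ n) atTop (𝓝 0) :=
    tendsto_pow_atTop_nhds_zero_of_lt_one h2.le (by linarith [hl.1])
  have hle : ∀ n, |codePt l w - y| ≤ (1 - l) ^ n := by
    intro n
    refine le_trans ?_ (cylLen_le hl (w := w) (n := n))
    have h1 := codePt_mem_cyl hl w n
    have h3 := hTn n
    have h0 := cylLen_pos hl (w := w) (n := n)
    have h4 := key n
    have h5 := mul_pos h0 h3.1
    have h6 := mul_le_of_le_one_right h0.le h3.2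
    rw [abs_le]
    constructor <;> linarith [h1.1, h1.2]
  have := ge_of_tendsto' hlim hle
  linarith [abs_eq_zero.1 (le_antisymm this (abs_nonneg _))]

lemma tsum_prod_fin (g : ℕ → ENNReal) (n : ℕ) :
    ∑' u : Fin n → ℕ, ∏ i, g (u i) = (∑' j, g j) ^ n := by
  induction n with
  | zero => simp [tsum_fintype]
  | succ n ih =>
    rw [← (Fin.consEquiv fun _ => ℕ).tsum_eq, ENNReal.tsum_prod', pow_succ', ← ih,
      ← ENNReal.tsum_mul_right]
    refine tsum_congr fun a => ?_
    rw [← ENNReal.tsum_mul_left]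
    refine tsum_congr fun u => ?_
    simp [Fin.consEquiv, Fin.prod_univ_succ]

/-- The extension of a finite word by zeros. -/
def extendWord {n : ℕ} (u : Fin n → ℕ) (i : ℕ) : ℕ := if h : i < n then u ⟨i, h⟩ else 0

lemma extendWord_restrict (w : ℕ → ℕ) {n i : ℕ} (hi : i < n) :
    extendWord (fun k : Fin n => w k) i = w i := by
  simp [extendWord, hi]

lemma cylLen_rpow_mul (hl : l ∈ Ioo (0 : ℝ) 1) {σ θ : ℝ} (c : ℝ) (hθ : 0 < θ) (w : ℕ → ℕ)
    (n : ℕ) : cylLen l w n ^ σ * θ ^ ((digitSum w n : ℝ) - c * n) =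
      ∏ i ∈ Finset.range n, (1 - l) ^ σ * θ ^ (-c) * (l ^ σ * θ) ^ w i := by
  have h2 : 0 < 1 - l := by linarith [hl.2]
  induction n with
  | zero => simp [cylLen_zero, digitSum]
  | succ n ih =>
    rw [Finset.prod_range_succ, ← ih, cylLen_succ, digitSum_succ,
      Real.mul_rpow (cylLen_pos hl).le (by have := hl.1; positivity),
      Real.mul_rpow h2.le (pow_pos hl.1 _).le, mul_pow, ← Real.rpow_natCast (l ^ σ),
      ← Real.rpow_mul hl.1.le, ← Real.rpow_natCast l, ← Real.rpow_mul hl.1.le, mul_comm σ]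
    have : θ ^ (((digitSum w n + w n : ℕ) : ℝ) - c * (n + 1 : ℕ)) =
        θ ^ ((digitSum w n : ℝ) - c * n) * θ ^ (-c) * θ ^ w n := by
      rw [← Real.rpow_natCast θ (w n), ← Real.rpow_add hθ, ← Real.rpow_add hθ]
      congr 1
      push_cast
      ring
    rw [this]
    ring

/-- The basic covering estimate: an exponential Chebyshev inequality shows that the points whose
digit sums infinitely often lie on one side of `c * n` form a null set. -/
lemma hausdorffMeasure_frequently_eq_zero (hl : l ∈ Ioo (0 : ℝ) 1) {σ θ c : ℝ} (hσ : 0 < σ)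
    (hθ : 0 < θ) (hlt : l ^ σ * θ < 1)
    (hρ : (1 - l) ^ σ * θ ^ (-c) / (1 - l ^ σ * θ) < 1) :
    Measure.hausdorffMeasure σ
      {x : ℝ | ∃ w, codePt l w = x ∧
        ∃ᶠ n in atTop, 1 ≤ θ ^ ((digitSum w n : ℝ) - c * (n : ℝ))} = 0 := by
  classical
  have hl0 := hl.1
  have h2 : 0 < 1 - l := by linarith [hl.2]
  set ρ := (1 - l) ^ σ * θ ^ (-c) / (1 - l ^ σ * θ) with hρdef
  have hρ0 : 0 ≤ ρ := div_nonneg (by positivity) (by linarith)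
  let bad : ∀ n, (Fin n → ℕ) → Prop := fun n u =>
    1 ≤ θ ^ ((digitSum (extendWord u) n : ℝ) - c * (n : ℝ))
  let cyl : ∀ n, (Fin n → ℕ) → Set ℝ := fun n u =>
    if bad n u then Icc (cylLeft l (extendWord u) n)
      (cylLeft l (extendWord u) n + cylLen l (extendWord u) n) else ∅
  let g : ℕ → ENNReal := fun j => ENNReal.ofReal ((1 - l) ^ σ * θ ^ (-c) * (l ^ σ * θ) ^ j)
  have hg : ∑' j, g j = ENNReal.ofReal ρ := by
    have hs := summable_geometric_of_lt_one (r := l ^ σ * θ) (by positivity) hlt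
    rw [← ENNReal.ofReal_tsum_of_nonneg (fun j => by positivity) (hs.mul_left _), tsum_mul_left,
      tsum_geometric_of_lt_one (by positivity) hlt, hρdef, div_eq_mul_inv]
  have hdiam : ∀ n u, Metric.ediam (cyl n u) ≤ ENNReal.ofReal ((1 - l) ^ n) := by
    intro n u
    by_cases hb : bad n u
    · simp only [cyl, hb, if_true, Real.ediam_Icc, add_sub_cancel_left]
      exact ENNReal.ofReal_le_ofReal (cylLen_le hl)
    · simp [cyl, hb]
  have hdiamσ : ∀ n u, Metric.ediam (cyl n u) ^ σ ≤ ∏ i, g (u i) := by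
    intro n u
    by_cases hb : bad n u
    · simp only [cyl, hb, if_true, Real.ediam_Icc, add_sub_cancel_left]
      rw [ENNReal.ofReal_rpow_of_pos (cylLen_pos hl)]
      have e : ∏ i, g (u i) = ENNReal.ofReal
          (∏ i ∈ Finset.range n, (1 - l) ^ σ * θ ^ (-c) * (l ^ σ * θ) ^ extendWord u i) := by
        rw [ENNReal.ofReal_prod_of_nonneg (fun i _ => by positivity), Finset.prod_range]
        simp [g, extendWord]
      rw [e, ← cylLen_rpow_mul hl c hθ]
      exact ENNReal.ofReal_le_ofReal
        (le_mul_of_one_le_right (Real.rpow_nonneg (cylLen_pos hl).le _) hb)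
    · simp [cyl, hb, hσ]
  have hsum : ∀ n, ∑' u, Metric.ediam (cyl n u) ^ σ ≤ ENNReal.ofReal ρ ^ n := fun n =>
    (ENNReal.tsum_le_tsum (hdiamσ n)).trans_eq (by rw [tsum_prod_fin, hg])
  have hbound := Measure.hausdorffMeasure_le_liminf_tsum (X := ℝ) (β := ℕ)
    (ι := fun n => Σ k : ℕ, Fin (n + k) → ℕ) σ
    {x : ℝ | ∃ w, codePt l w = x ∧
        ∃ᶠ n in atTop, 1 ≤ θ ^ ((digitSum w n : ℝ) - c * (n : ℝ))} (l := atTop)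
    (fun n => ENNReal.ofReal ((1 - l) ^ n))
    (by
      rw [← ENNReal.ofReal_zero]
      exact ENNReal.tendsto_ofReal
        (tendsto_pow_atTop_nhds_zero_of_lt_one h2.le (by linarith)))
    (fun n p => cyl (n + p.1) p.2)
    (Eventually.of_forall fun n p => (hdiam _ _).trans (ENNReal.ofReal_le_ofReal
      (pow_le_pow_of_le_one h2.le (by linarith) (Nat.le_add_right _ _))))
    (Eventually.of_forall fun n => by
      rintro x ⟨w, rfl, hw⟩
      obtain ⟨N, hN, hb⟩ := frequently_atTop.1 hw n
      obtain ⟨k, rfl⟩ := Nat.exists_eq_add_of_le hN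
      refine mem_iUnion.2 ⟨⟨k, fun i => w i⟩, ?_⟩
      have hcongr : ∀ i < n + k, extendWord (fun i : Fin (n + k) => w i) i = w i :=
        fun i hi => extendWord_restrict w hi
      have hS : digitSum (extendWord fun i : Fin (n + k) => w i) (n + k) = digitSum w (n + k) :=
        Finset.sum_congr rfl fun i hi => hcongr i (Finset.mem_range.1 hi)
      have hbad : bad (n + k) (fun i => w i) := by
        simp only [bad, hS]
        exact hb
      simp only [cyl, hbad, if_true, cylLen_congr hcongr, cylLeft_congr hcongr]
      exact Ioc_subset_Icc_self (codePt_mem_cyl hl w _))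
  refine le_antisymm (hbound.trans ?_) zero_le
  have hle : ∀ n, ∑' p : Σ k : ℕ, Fin (n + k) → ℕ, Metric.ediam (cyl (n + p.1) p.2) ^ σ ≤
      ENNReal.ofReal ρ ^ n * (1 - ENNReal.ofReal ρ)⁻¹ := by
    intro n
    rw [ENNReal.tsum_sigma' , ← ENNReal.tsum_geometric, ← ENNReal.tsum_mul_left]
    refine ENNReal.tsum_le_tsum fun k => ?_
    rw [← pow_add]
    exact hsum _
  have hρ1 : ENNReal.ofReal ρ < 1 := by rwa [ENNReal.ofReal_lt_one]
  have hlim : Tendsto (fun n : ℕ => ENNReal.ofReal ρ ^ n * (1 - ENNReal.ofReal ρ)⁻¹) atTop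
      (𝓝 0) := by
    have := ENNReal.Tendsto.mul_const (b := (1 - ENNReal.ofReal ρ)⁻¹)
      (ENNReal.tendsto_pow_atTop_nhds_zero_of_lt_one hρ1)
      (Or.inr (ENNReal.inv_ne_top.2 (tsub_pos_of_lt hρ1).ne'))
    rwa [zero_mul] at this
  exact (liminf_le_liminf (Eventually.of_forall hle)).trans_eq hlim.liminf_eq

lemma codePt_of_forall_eq_zero (hl : l ∈ Ioo (0 : ℝ) 1) (h : ∀ n, w n = 0) : codePt l w = 1 := by
  obtain ⟨v, hv⟩ := exists_codePt_eq hl (y := 1) ⟨one_pos, le_rfl⟩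
  rw [show w = v from funext fun n => by rw [h, codePt_eq_one hl n hv], hv]

lemma cylRight_add_of_eq_zero {k : ℕ} (h : ∀ i < k, w (n + i) = 0) :
    cylLeft l w (n + k) + cylLen l w (n + k) = cylLeft l w n + cylLen l w n := by
  induction k with
  | zero => rfl
  | succ k ih =>
    rw [← ih fun i hi => h i (by omega), ← add_assoc, cylRight_succ, h k (by omega), pow_zero,
      mul_one]

section Comparison

variable {m σ M : ℝ}

lemma le_mul_rpow_of_cylLen_le (hl : l ∈ Ioo (0 : ℝ) 1) (hm : m ∈ Ioo (0 : ℝ) 1)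
    (hσ : 0 < σ) (hM : 0 ≤ M)
    (h : cylLen m w n ≤ M * cylLen l w n ^ σ) {x z : ℝ} (hx : x ≤ cylLen m w n / (1 - m))
    (hz : l * (1 - l) * cylLen l w n ≤ z) :
    x ≤ M / (1 - m) * (1 / (l * (1 - l))) ^ σ * z ^ σ := by
  have hl0 := hl.1
  have h1 : 0 < 1 - l := by linarith [hl.2]
  have h2 : 0 < 1 - m := by linarith [hm.2]
  have hp := cylLen_pos hl (w := w) (n := n)
  have hz0 : 0 ≤ z := le_trans (by positivity) hz
  rw [mul_assoc, ← Real.mul_rpow (by positivity) hz0]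
  calc x ≤ M * cylLen l w n ^ σ / (1 - m) := hx.trans (by gcongr)
    _ = M / (1 - m) * cylLen l w n ^ σ := by ring
    _ ≤ _ := by
      gcongr
      rw [one_div, ← div_eq_inv_mul, le_div_iff₀ (by positivity)]
      linarith

lemma codePt_sub_cylLeft_le (hl : l ∈ Ioo (0 : ℝ) 1) (hm : m ∈ Ioo (0 : ℝ) 1)
    (hσ : 0 < σ) (hM : 0 ≤ M) (h : ∀ n, cylLen m w n ≤ M * cylLen l w n ^ σ) (n : ℕ) :
    codePt m w - cylLeft m w n ≤
      M / (1 - m) * (1 / (l * (1 - l))) ^ σ * (codePt l w - cylLeft l w n) ^ σ := by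
  have h1 : 0 < 1 - l := by linarith [hl.2]
  have h2 : 0 < 1 - m := by linarith [hm.2]
  refine le_mul_rpow_of_cylLen_le hl hm hσ hM (h (n + 1)) ?_ ?_
  · rw [codePt_eq hm w n, add_sub_cancel_left, le_div_iff₀ h2, cylLen_succ]
    have := mul_le_mul_of_nonneg_left (codePt_digit hm fun i => w (n + i)).2
      (mul_pos (cylLen_pos hm (w := w) (n := n)) h2).le
    simp only [add_zero] at this
    linarith
  · rw [codePt_eq hl w n, add_sub_cancel_left, cylLen_succ]
    have h3 := mul_le_mul_of_nonneg_left (codePt_digit hl fun i => w (n + i)).1.le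
      (cylLen_pos hl (w := w) (n := n)).le
    simp only [add_zero] at h3
    refine le_trans ?_ h3
    have h4 : 0 < cylLen l w n * l ^ (w n + 1) := term_pos hl n
    have h5 : (1 - l) * (1 - l) ≤ 1 := by nlinarith [hl.1]
    calc l * (1 - l) * (cylLen l w n * ((1 - l) * l ^ w n))
        = (1 - l) * (1 - l) * (cylLen l w n * l ^ (w n + 1)) := by ring
      _ ≤ _ := mul_le_of_le_one_left h4.le h5

lemma cylRight_sub_codePt_le (hl : l ∈ Ioo (0 : ℝ) 1) (hm : m ∈ Ioo (0 : ℝ) 1)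
    (hσ : 0 < σ) (hM : 0 ≤ M) (h : ∀ n, cylLen m w n ≤ M * cylLen l w n ^ σ) (n : ℕ) :
    cylLeft m w n + cylLen m w n - codePt m w ≤
      M / (1 - m) * (1 / (l * (1 - l))) ^ σ *
        (cylLeft l w n + cylLen l w n - codePt l w) ^ σ := by
  classical
  have h1 : 0 < 1 - l := by linarith [hl.2]
  have h2 : 0 < 1 - m := by linarith [hm.2]
  by_cases hw : ∀ k, w (n + k) = 0
  · rw [codePt_eq hm w n, codePt_eq hl w n, codePt_of_forall_eq_zero hm hw,
      codePt_of_forall_eq_zero hl hw]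
    simp [Real.zero_rpow hσ.ne']
  · push Not at hw
    have hk0 := Nat.find_spec hw
    have hk : ∀ i < Nat.find hw, w (n + i) = 0 := fun i hi => not_not.1 (Nat.find_min hw hi)
    rw [← cylRight_add_of_eq_zero hk, ← cylRight_add_of_eq_zero hk]
    set N := n + Nat.find hw
    refine le_mul_rpow_of_cylLen_le hl hm hσ hM (h N) ?_ ?_
    · have h3 := (codePt_mem_cyl hm w N).1
      rw [le_div_iff₀ h2]
      nlinarith [cylLen_pos hm (w := w) (n := N), hm.1]
    · have h3 := cylLen_pos hl (w := w) (n := N)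
      have h4 := (codePt_digit hl fun i => w (N + i)).2
      have h5 : l ^ w (N + 0) ≤ l := pow_le_of_le_one hl.1.le hl.2.le hk0
      have h6 := mul_le_mul_of_nonneg_left (h4.trans h5) h3.le
      rw [codePt_eq hl w N]
      nlinarith [mul_pos h3 h1, hl.2]

lemma codePt_sub_le_of_lt (hl : l ∈ Ioo (0 : ℝ) 1) (hm : m ∈ Ioo (0 : ℝ) 1)
    (hσ : 0 < σ) (hM : 0 ≤ M) (hw : ∀ n, cylLen m w n ≤ M * cylLen l w n ^ σ)
    (hv : ∀ n, cylLen m v n ≤ M * cylLen l v n ^ σ) (heq : ∀ i < n, w i = v i)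
    (hlt : w n < v n) :
    |codePt m w - codePt m v| ≤ 2 * (M / (1 - m) * (1 / (l * (1 - l))) ^ σ) *
      |codePt l w - codePt l v| ^ σ := by
  have hl0 := hl.1
  have h1 : 0 < 1 - l := by linarith [hl.2]
  have h2 : 0 < 1 - m := by linarith [hm.2]
  have hle : ∀ {r : ℝ}, r ∈ Ioo (0 : ℝ) 1 → codePt r v ≤ cylLeft r w (n + 1) := by
    intro r hr
    refine (codePt_mem_cyl hr v (n + 1)).2.trans ?_
    rw [cylRight_succ, cylLeft_succ, cylLeft_congr heq, cylLen_congr heq]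
    have := mul_le_mul_of_nonneg_left (pow_le_pow_of_le_one hr.1.le hr.2.le hlt)
      (cylLen_pos hr (w := v) (n := n)).le
    simpa using this
  have hright : cylLeft m w (n + 1) - codePt m v ≤
      M / (1 - m) * (1 / (l * (1 - l))) ^ σ * (cylLeft l w (n + 1) - codePt l v) ^ σ := by
    rcases Nat.lt_or_ge (w n + 1) (v n) with hgap | hgap
    · refine le_mul_rpow_of_cylLen_le hl hm hσ hM (hw (n + 1)) ?_ ?_
      · have h3 := (codePt_mem_cyl hm v n).1
        rw [← cylLeft_congr heq] at h3
        rw [cylLeft_succ, le_div_iff₀ h2, cylLen_succ]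
        have h4 : m ^ (w n + 1) ≤ m ^ w n :=
          pow_le_pow_of_le_one hm.1.le hm.2.le (Nat.le_succ _)
        have h5 := mul_le_mul_of_nonneg_left h4 (cylLen_pos hm (w := w) (n := n)).le
        nlinarith
      · have h3 := (codePt_mem_cyl hl v (n + 1)).2
        rw [cylRight_succ, ← cylLeft_congr heq, ← cylLen_congr heq] at h3
        have h4 : l ^ v n ≤ l ^ (w n + 2) := pow_le_pow_of_le_one hl.1.le hl.2.le hgap
        have h5 := mul_le_mul_of_nonneg_left h4 (cylLen_pos hl (w := w) (n := n)).le
        have h6 : 0 < cylLen l w n * l ^ (w n + 1) := term_pos hl n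
        rw [cylLeft_succ, cylLen_succ]
        have h7 : l * (1 - l) * (cylLen l w n * ((1 - l) * l ^ w n)) ≤
            cylLen l w n * l ^ (w n + 1) - cylLen l w n * l ^ (w n + 2) := by
          have e1 : l * (1 - l) * (cylLen l w n * ((1 - l) * l ^ w n)) =
            (cylLen l w n * l ^ (w n + 1)) * ((1 - l) * (1 - l)) := by ring
          have e2 : cylLen l w n * l ^ (w n + 1) - cylLen l w n * l ^ (w n + 2) =
            (cylLen l w n * l ^ (w n + 1)) * (1 - l) := by ring
          rw [e1, e2]
          exact mul_le_mul_of_nonneg_left (mul_le_of_le_one_left h1.le (by linarith)) h6.le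
        linarith
    · have hvn : v n = w n + 1 := le_antisymm hgap hlt
      have e : ∀ r : ℝ, cylLeft r w (n + 1) = cylLeft r v (n + 1) + cylLen r v (n + 1) := by
        intro r
        rw [cylRight_succ, cylLeft_succ, cylLeft_congr heq, cylLen_congr heq, hvn]
      rw [e, e]
      exact cylRight_sub_codePt_le hl hm hσ hM hv (n + 1)
  have hleft := codePt_sub_cylLeft_le hl hm hσ hM hw (n + 1)
  have a1 := (codePt_mem_cyl hl w (n + 1)).1
  have a2 := hle hl
  have a3 := (codePt_mem_cyl hm w (n + 1)).1
  have a4 := hle hm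
  rw [abs_of_nonneg (by linarith), abs_of_nonneg (by linarith)]
  have hK : 0 ≤ M / (1 - m) * (1 / (l * (1 - l))) ^ σ := by positivity
  have b1 : (codePt l w - cylLeft l w (n + 1)) ^ σ ≤ (codePt l w - codePt l v) ^ σ :=
    Real.rpow_le_rpow (by linarith) (by linarith) hσ.le
  have b2 : (cylLeft l w (n + 1) - codePt l v) ^ σ ≤ (codePt l w - codePt l v) ^ σ :=
    Real.rpow_le_rpow (by linarith) (by linarith) hσ.le
  have c1 := mul_le_mul_of_nonneg_left b1 hK
  have c2 := mul_le_mul_of_nonneg_left b2 hK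
  linarith

lemma abs_codePt_sub_le (hl : l ∈ Ioo (0 : ℝ) 1) (hm : m ∈ Ioo (0 : ℝ) 1)
    (hσ : 0 < σ) (hM : 0 ≤ M) (hw : ∀ n, cylLen m w n ≤ M * cylLen l w n ^ σ)
    (hv : ∀ n, cylLen m v n ≤ M * cylLen l v n ^ σ) :
    |codePt m w - codePt m v| ≤ 2 * (M / (1 - m) * (1 / (l * (1 - l))) ^ σ) *
      |codePt l w - codePt l v| ^ σ := by
  classical
  by_cases h : ∃ n, w n ≠ v n
  · have heq : ∀ i < Nat.find h, w i = v i := fun i hi => not_not.1 (Nat.find_min h hi)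
    rcases lt_or_gt_of_ne (Nat.find_spec h) with hlt | hlt
    · exact codePt_sub_le_of_lt hl hm hσ hM hw hv heq hlt
    · rw [abs_sub_comm, abs_sub_comm (codePt l w)]
      exact codePt_sub_le_of_lt hl hm hσ hM hv hw (fun i hi => (heq i hi).symm) hlt
  · push Not at h
    obtain rfl : w = v := funext h
    simp [Real.zero_rpow hσ.ne']

lemma dimH_image_codePt_le (hl : l ∈ Ioo (0 : ℝ) 1) (hm : m ∈ Ioo (0 : ℝ) 1)
    (hσ : 0 < σ) (hM : 0 ≤ M) {s : Set (ℕ → ℕ)}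
    (hs : ∀ w ∈ s, ∀ n, cylLen m w n ≤ M * cylLen l w n ^ σ) :
    dimH (codePt m '' s) ≤ dimH (codePt l '' s) / ENNReal.ofReal σ := by
  classical
  have h2 : 0 < 1 - m := by linarith [hm.2]
  have h1 : 0 < 1 - l := by linarith [hl.2]
  have hl0 := hl.1
  set K := 2 * (M / (1 - m) * (1 / (l * (1 - l))) ^ σ) with hKdef
  have hK : 0 ≤ K := by positivity
  choose! d hd hdl using fun x (hx : x ∈ codePt l '' s) => hx
  have hholder : HolderOnWith K.toNNReal σ.toNNReal (codePt m ∘ d) (codePt l '' s) := by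
    intro x hx y hy
    have h := abs_codePt_sub_le hl hm hσ hM (hs _ (hd x hx)) (hs _ (hd y hy))
    rw [hdl x hx, hdl y hy] at h
    rw [edist_dist, edist_dist, Real.dist_eq, Real.dist_eq, Real.coe_toNNReal _ hσ.le,
      ENNReal.ofReal_rpow_of_nonneg (abs_nonneg _) hσ.le]
    change _ ≤ ENNReal.ofReal K * _
    rw [← ENNReal.ofReal_mul hK]
    exact ENNReal.ofReal_le_ofReal h
  refine (dimH_mono ?_).trans (hholder.dimH_image_le (Real.toNNReal_pos.2 hσ))
  rintro _ ⟨w, hw, rfl⟩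
  have hx : codePt l w ∈ codePt l '' s := mem_image_of_mem _ hw
  refine ⟨codePt l w, hx, ?_⟩
  have h := abs_codePt_sub_le hl hm hσ hM (hs _ (hd _ hx)) (hs _ hw)
  rw [hdl _ hx, sub_self, abs_zero, Real.zero_rpow hσ.ne', mul_zero] at h
  exact sub_eq_zero.1 (abs_eq_zero.1 (le_antisymm h (abs_nonneg _)))

end Comparison

/-- The digit sequences with asymptotic digit average `q`. -/
def typicalDigits (q : ℝ) : Set (ℕ → ℕ) :=
  {w | Tendsto (fun n : ℕ => (digitSum w n : ℝ) / n) atTop (𝓝 q)}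

section LawOfLargeNumbers

variable {m c : ℝ}

lemma tendsto_slope_chernoff (hm : m ∈ Ioo (0 : ℝ) 1) (c : ℝ) :
    Tendsto (slope (fun θ => Real.log (1 - m) - c * Real.log θ - Real.log (1 - m * θ)) 1)
      (𝓝[≠] 1) (𝓝 (m / (1 - m) - c)) := by
  have h2 : 0 < 1 - m := by linarith [hm.2]
  rw [← hasDerivAt_iff_tendsto_slope]
  have h1 := (Real.hasDerivAt_log one_ne_zero).const_mul c
  have h3 : HasDerivAt (fun θ : ℝ => 1 - m * θ) (-m) 1 := by
    simpa using ((hasDerivAt_id (1 : ℝ)).const_mul m).const_sub 1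
  have h4 := h3.log (by simpa using h2.ne')
  have h5 := (h1.const_sub (Real.log (1 - m))).sub h4
  refine h5.congr_deriv ?_
  rw [mul_one]
  ring

lemma volume_frequently_eq_zero (hm : m ∈ Ioo (0 : ℝ) 1) {θ : ℝ} (hθ : 0 < θ) (hmθ : m * θ < 1)
    (hlog : Real.log (1 - m) - c * Real.log θ - Real.log (1 - m * θ) < 0) :
    volume {x : ℝ | ∃ w, codePt m w = x ∧
        ∃ᶠ n in atTop, 1 ≤ θ ^ ((digitSum w n : ℝ) - c * (n : ℝ))} = 0 := by
  have h2 : 0 < 1 - m := by linarith [hm.2]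
  rw [← hausdorffMeasure_real]
  refine hausdorffMeasure_frequently_eq_zero hm one_pos hθ (by simpa using hmθ) ?_
  have h3 : 0 < 1 - m * θ := by linarith
  have h4 := Real.rpow_pos_of_pos hθ (-c)
  rw [Real.rpow_one, Real.rpow_one]
  refine (Real.log_neg_iff (by positivity)).1 ?_
  rw [Real.log_div (by positivity) h3.ne', Real.log_mul h2.ne' h4.ne', Real.log_rpow hθ]
  linarith

lemma volume_frequently_ge_eq_zero (hm : m ∈ Ioo (0 : ℝ) 1) (hc : m / (1 - m) < c) :
    volume {x : ℝ | ∃ w, codePt m w = x ∧ ∃ᶠ n : ℕ in atTop, c * (n : ℝ) ≤ digitSum w n} = 0 := by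
  have hev := ((tendsto_slope_chernoff hm c).mono_left
    (nhdsWithin_mono 1 (show Ioi (1 : ℝ) ⊆ {1}ᶜ from fun x hx => ne_of_gt hx))).eventually_lt_const (sub_neg.2 hc)
  have hev2 : ∀ᶠ θ in 𝓝[>] (1 : ℝ), m * θ < 1 :=
    nhdsWithin_le_nhds ((continuous_const_mul m).tendsto 1 |>.eventually_lt_const
      (by simpa using hm.2))
  obtain ⟨θ, ⟨hs, hmθ⟩, hθ⟩ := ((hev.and hev2).and self_mem_nhdsWithin).exists
  have hθ : 1 < θ := hθ
  rw [slope_def_field, div_lt_iff₀ (by linarith)] at hs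
  refine measure_mono_null ?_ (volume_frequently_eq_zero (c := c) hm (by linarith) hmθ
    (by simpa using hs))
  rintro x ⟨w, rfl, hw⟩
  exact ⟨w, rfl, hw.mono fun n hn => Real.one_le_rpow hθ.le (by linarith)⟩

lemma volume_frequently_le_eq_zero (hm : m ∈ Ioo (0 : ℝ) 1) (hc : c < m / (1 - m)) :
    volume {x : ℝ | ∃ w, codePt m w = x ∧ ∃ᶠ n : ℕ in atTop, digitSum w n ≤ c * (n : ℝ)} = 0 := by
  have hev := ((tendsto_slope_chernoff hm c).mono_left
    (nhdsWithin_mono 1 (show Iio (1 : ℝ) ⊆ {1}ᶜ from fun x hx => ne_of_lt hx))).eventually_const_lt (sub_pos.2 hc)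
  have hev2 : ∀ᶠ θ in 𝓝[<] (1 : ℝ), 0 < θ :=
    nhdsWithin_le_nhds (eventually_gt_nhds one_pos)
  obtain ⟨θ, ⟨hs, hθ0⟩, hθ⟩ := ((hev.and hev2).and self_mem_nhdsWithin).exists
  have hθ : θ < 1 := hθ
  rw [slope_def_field, lt_div_iff_of_neg (by linarith)] at hs
  refine measure_mono_null ?_ (volume_frequently_eq_zero (c := c) hm hθ0
    (by nlinarith [hm.1, hm.2]) (by simpa using hs))
  rintro x ⟨w, rfl, hw⟩
  exact ⟨w, rfl, hw.mono fun n hn =>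
    Real.one_le_rpow_of_pos_of_le_one_of_nonpos hθ0 hθ.le (by linarith)⟩

lemma volume_image_compl_typicalDigits (hm : m ∈ Ioo (0 : ℝ) 1) :
    volume (codePt m '' (typicalDigits (m / (1 - m)))ᶜ) = 0 := by
  set q := m / (1 - m)
  refine measure_mono_null (t := (⋃ r : {r : ℚ // q < r}, {x : ℝ | ∃ w, codePt m w = x ∧
      ∃ᶠ n : ℕ in atTop, (r : ℝ) * (n : ℝ) ≤ digitSum w n}) ∪
    ⋃ r : {r : ℚ // (r : ℝ) < q}, {x : ℝ | ∃ w, codePt m w = x ∧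
      ∃ᶠ n : ℕ in atTop, digitSum w n ≤ (r : ℝ) * (n : ℝ)}) ?_ ?_
  · rintro _ ⟨w, hw, rfl⟩
    by_contra hcon
    simp only [mem_union, mem_iUnion, mem_ofPred_eq, not_or, not_exists, not_and,
      not_frequently, not_le] at hcon
    refine hw (tendsto_order.2 ⟨fun a ha => ?_, fun a ha => ?_⟩)
    · obtain ⟨r, har, hrq⟩ := exists_rat_btwn ha
      filter_upwards [hcon.2 ⟨r, hrq⟩ w rfl, eventually_gt_atTop 0] with n hn hn0
      have hn0 : (0 : ℝ) < n := by exact_mod_cast hn0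
      rw [lt_div_iff₀ hn0]
      exact lt_trans (by gcongr) hn
    · obtain ⟨r, har, hrq⟩ := exists_rat_btwn ha
      filter_upwards [hcon.1 ⟨r, har⟩ w rfl, eventually_gt_atTop 0] with n hn hn0
      have hn0 : (0 : ℝ) < n := by exact_mod_cast hn0
      rw [div_lt_iff₀ hn0]
      exact lt_trans hn (by gcongr)
  · exact measure_union_null
      (measure_iUnion_null fun r => volume_frequently_ge_eq_zero hm r.2)
      (measure_iUnion_null fun r => volume_frequently_le_eq_zero hm r.2)

lemma one_le_dimH_image_typicalDigits (hm : m ∈ Ioo (0 : ℝ) 1) :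
    1 ≤ dimH (codePt m '' typicalDigits (m / (1 - m))) := by
  have h : (1 : ENNReal) ≤ volume (codePt m '' typicalDigits (m / (1 - m))) := by
    calc (1 : ENNReal) = volume (Ioc (0 : ℝ) 1) := by simp
      _ ≤ volume (codePt m '' typicalDigits (m / (1 - m)) ∪
            codePt m '' (typicalDigits (m / (1 - m)))ᶜ) := by
        refine measure_mono fun y hy => ?_
        obtain ⟨w, rfl⟩ := exists_codePt_eq hm hy
        rw [← image_union, union_compl_self]
        exact mem_image_of_mem _ (mem_univ w)
      _ ≤ _ := (measure_union_le _ _).trans_eq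
        (by rw [volume_image_compl_typicalDigits hm, add_zero])
  rw [← hausdorffMeasure_real] at h
  exact_mod_cast le_dimH_of_hausdorffMeasure_ne_zero (d := 1)
    (by rw [NNReal.coe_one]; exact (one_pos.trans_le h).ne')

end LawOfLargeNumbers

section Dimension

variable {m σ t q : ℝ}

lemma log_cylLen (hl : l ∈ Ioo (0 : ℝ) 1) :
    Real.log (cylLen l w n) = n * Real.log (1 - l) + digitSum w n * Real.log l := by
  have h2 : 0 < 1 - l := by linarith [hl.2]
  rw [cylLen_eq, Real.log_mul (pow_pos h2 _).ne' (pow_pos hl.1 _).ne', Real.log_pow, Real.log_pow]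

lemma eventually_cylLen_le (hl : l ∈ Ioo (0 : ℝ) 1) (hm : m ∈ Ioo (0 : ℝ) 1)
    (hw : w ∈ typicalDigits q)
    (h : Real.log (1 - m) + q * Real.log m < σ * (Real.log (1 - l) + q * Real.log l)) :
    ∀ᶠ n in atTop, cylLen m w n ≤ cylLen l w n ^ σ := by
  have hw : Tendsto (fun n : ℕ => (digitSum w n : ℝ) / n) atTop (𝓝 q) := hw
  have hlim : Tendsto (fun n : ℕ => (Real.log (1 - m) + (digitSum w n : ℝ) / n * Real.log m) -
      σ * (Real.log (1 - l) + (digitSum w n : ℝ) / n * Real.log l)) atTop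
      (𝓝 ((Real.log (1 - m) + q * Real.log m) - σ * (Real.log (1 - l) + q * Real.log l))) :=
    ((hw.mul_const _).const_add _).sub (((hw.mul_const _).const_add _).const_mul _)
  filter_upwards [hlim.eventually_lt_const (sub_neg.2 h), eventually_gt_atTop 0] with n hn hn0
  have hn0 : (0 : ℝ) < n := by exact_mod_cast hn0
  rw [← Real.log_le_log_iff (cylLen_pos hm) (Real.rpow_pos_of_pos (cylLen_pos hl) _),
    Real.log_rpow (cylLen_pos hl), log_cylLen hl, log_cylLen hm]
  have := mul_neg_of_pos_of_neg hn0 hn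
  have e : (n : ℝ) * ((Real.log (1 - m) + (digitSum w n : ℝ) / n * Real.log m) -
      σ * (Real.log (1 - l) + (digitSum w n : ℝ) / n * Real.log l)) =
      (n * Real.log (1 - m) + digitSum w n * Real.log m) -
      σ * (n * Real.log (1 - l) + digitSum w n * Real.log l) := by
    field_simp
  linarith

lemma le_dimH_image_typicalDigits (hl : l ∈ Ioo (0 : ℝ) 1) (hm : m ∈ Ioo (0 : ℝ) 1) (hσ : 0 < σ)
    (h : Real.log (1 - m) + m / (1 - m) * Real.log m <
      σ * (Real.log (1 - l) + m / (1 - m) * Real.log l)) :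
    ENNReal.ofReal σ ≤ dimH (codePt l '' typicalDigits (m / (1 - m))) := by
  set q := m / (1 - m)
  let s : ℕ → Set (ℕ → ℕ) := fun M =>
    {w ∈ typicalDigits q | ∀ n, cylLen m w n ≤ M * cylLen l w n ^ σ}
  have hs : codePt m '' typicalDigits q ⊆ ⋃ M, codePt m '' s M := by
    rintro _ ⟨w, hw, rfl⟩
    obtain ⟨N, hN⟩ := eventually_atTop.1 (eventually_cylLen_le hl hm hw h)
    have hpos : ∀ n, 0 < cylLen l w n ^ σ := fun n => Real.rpow_pos_of_pos (cylLen_pos hl) _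
    obtain ⟨M, hM⟩ := exists_nat_ge
      (1 + ∑ n ∈ Finset.range N, cylLen m w n / cylLen l w n ^ σ)
    have hnn : ∀ n, 0 ≤ cylLen m w n / cylLen l w n ^ σ :=
      fun n => (div_pos (cylLen_pos hm) (hpos n)).le
    refine mem_iUnion.2 ⟨M, w, ⟨hw, fun n => ?_⟩, rfl⟩
    rw [← div_le_iff₀ (hpos n)]
    refine le_trans ?_ hM
    rcases lt_or_ge n N with hn | hn
    · have := Finset.single_le_sum (fun i _ => hnn i) (Finset.mem_range.2 hn)
      linarith
    · have h1 : cylLen m w n / cylLen l w n ^ σ ≤ 1 := (div_le_one (hpos n)).2 (hN n hn)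
      have h2 := Finset.sum_nonneg fun i (_ : i ∈ Finset.range N) => hnn i
      linarith
  have hle : (1 : ENNReal) ≤ dimH (codePt l '' typicalDigits q) / ENNReal.ofReal σ := by
    refine (one_le_dimH_image_typicalDigits hm).trans ((dimH_mono hs).trans ?_)
    rw [dimH_iUnion]
    refine iSup_le fun M => ?_
    refine (dimH_image_codePt_le hl hm hσ M.cast_nonneg fun w hw => hw.2).trans ?_
    gcongr
    exact fun w hw => hw.1
  rwa [ENNReal.le_div_iff_mul_le (Or.inl (by simpa using hσ)) (Or.inl ENNReal.ofReal_ne_top),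
    one_mul] at hle

lemma dimH_frequently_le (hl : l ∈ Ioo (0 : ℝ) 1) (hσ : 0 < σ) (hσt : σ ≤ t)
    (h : σ * Real.log (1 - l) - Real.log (1 - l ^ t) - q * ((t - σ) * Real.log l) < 0) :
    dimH {x : ℝ | ∃ w, codePt l w = x ∧
      ∀ c > q, ∃ᶠ n : ℕ in atTop, digitSum w n ≤ c * (n : ℝ)} ≤ ENNReal.ofReal σ := by
  have hl0 := hl.1
  have h2 : 0 < 1 - l := by linarith [hl.2]
  have hlt : l ^ t < 1 := Real.rpow_lt_one hl0.le hl.2 (by linarith)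
  have hcont : Tendsto (fun c : ℝ =>
      σ * Real.log (1 - l) - Real.log (1 - l ^ t) - c * ((t - σ) * Real.log l)) (𝓝[>] q)
      (𝓝 (σ * Real.log (1 - l) - Real.log (1 - l ^ t) - q * ((t - σ) * Real.log l))) :=
    ((continuous_const.sub (continuous_id.mul continuous_const)).tendsto q).mono_left nhdsWithin_le_nhds
  obtain ⟨c, hc, hcq⟩ := ((hcont.eventually_lt_const h).and self_mem_nhdsWithin).exists
  have hθ : 0 < l ^ (t - σ) := Real.rpow_pos_of_pos hl0 _
  have hmul : l ^ σ * l ^ (t - σ) = l ^ t := by rw [← Real.rpow_add hl0]; ring_nf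
  have hnull := hausdorffMeasure_frequently_eq_zero (c := c) hl hσ hθ (by rwa [hmul]) (by
    rw [hmul]
    have h3 : 0 < 1 - l ^ t := by linarith
    have h4 := Real.rpow_pos_of_pos hθ (-c)
    have h5 := Real.rpow_pos_of_pos h2 σ
    refine (Real.log_neg_iff (by positivity)).1 ?_
    rw [Real.log_div (by positivity) h3.ne', Real.log_mul h5.ne' h4.ne', Real.log_rpow hθ,
      Real.log_rpow h2, Real.log_rpow hl0]
    linarith)
  have hσ' : ENNReal.ofReal σ = (σ.toNNReal : ENNReal) := rfl
  refine (dimH_mono ?_).trans (hσ' ▸ dimH_le_of_hausdorffMeasure_ne_top (d := σ.toNNReal)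
    (by rw [Real.coe_toNNReal _ hσ.le, hnull]; exact ENNReal.zero_ne_top))
  rintro x ⟨w, rfl, hw⟩
  refine ⟨w, rfl, (hw c hcq).mono fun n hn => ?_⟩
  rw [← Real.rpow_mul hl0.le]
  exact Real.one_le_rpow_of_pos_of_le_one_of_nonpos hl0 hl.2.le
    (mul_nonpos_of_nonneg_of_nonpos (by linarith) (by linarith))

end Dimension

section Dynamics

/-- The length of the queue driven by the arrivals `w`, with one departure per unit of time. It
records the scale of the domain on which the next digit of an `Fmap`-orbit is read off. -/
def queue (w : ℕ → ℕ) : ℕ → ℕ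
  | 0 => 0
  | n + 1 => queue w n + w n - 1

/-- The number of times before `n` at which the queue is busy. -/
def busyTime (w : ℕ → ℕ) (n : ℕ) : ℕ :=
  ∑ i ∈ Finset.range n, if queue w i + w i = 0 then 0 else 1

lemma busyTime_succ (w : ℕ → ℕ) (n : ℕ) :
    busyTime w (n + 1) = busyTime w n + if queue w n + w n = 0 then 0 else 1 :=
  Finset.sum_range_succ _ _

lemma queue_add_busyTime (w : ℕ → ℕ) (n : ℕ) : queue w n + busyTime w n = digitSum w n := by
  induction n with
  | zero => simp [queue, busyTime, digitSum]
  | succ n ih =>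
    rw [busyTime_succ, digitSum_succ, queue]
    split_ifs <;> omega

lemma exists_queue_eq (w : ℕ → ℕ) (n : ℕ) :
    ∃ k ≤ n, queue w n + digitSum w k + n = digitSum w n + k := by
  induction n with
  | zero => exact ⟨0, le_rfl, by simp [queue]⟩
  | succ n ih =>
    obtain ⟨k, hk, h⟩ := ih
    rcases Nat.eq_zero_or_pos (queue w n + w n) with h0 | h0
    · exact ⟨n + 1, le_rfl, by rw [queue]; omega⟩
    · exact ⟨k, by omega, by rw [queue, digitSum_succ]; omega⟩

lemma tendsto_queue_div {q : ℝ} (hq : q ≤ 1) (hw : w ∈ typicalDigits q) :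
    Tendsto (fun n : ℕ => (queue w n : ℝ) / n) atTop (𝓝 0) := by
  have hw : Tendsto (fun n : ℕ => (digitSum w n : ℝ) / n) atTop (𝓝 q) := hw
  refine tendsto_order.2 ⟨fun a ha => Eventually.of_forall fun n => ha.trans_le (by positivity),
    fun ε hε => ?_⟩
  obtain ⟨N, hN⟩ := eventually_atTop.1 (hw.eventually (Metric.ball_mem_nhds q (ε := ε / 4)
    (by positivity)))
  obtain ⟨K, hK⟩ : ∃ K : ℝ, ∀ n, |(digitSum w n : ℝ) - q * n| ≤ ε / 4 * n + K := by
    have hnn : ∀ i, 0 ≤ |(digitSum w i : ℝ) - q * (i : ℝ)| := fun i => abs_nonneg _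
    refine ⟨∑ i ∈ Finset.range (N + 1), |(digitSum w i : ℝ) - q * (i : ℝ)|, fun n => ?_⟩
    rcases Nat.lt_or_ge n (N + 1) with hn | hn
    · have := Finset.single_le_sum (fun i _ => hnn i) (Finset.mem_range.2 hn)
      have h4 : 0 ≤ ε / 4 * n := by positivity
      linarith
    · have hn0 : (0 : ℝ) < n := by exact_mod_cast (by omega : 0 < n)
      have h1 := hN n (by omega)
      rw [Real.dist_eq, abs_lt, lt_sub_iff_add_lt, sub_lt_iff_lt_add, lt_div_iff₀ hn0,
        div_lt_iff₀ hn0] at h1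
      have h2 : |(digitSum w n : ℝ) - q * n| ≤ ε / 4 * n := by
        rw [abs_le]
        constructor <;> linarith [h1.1, h1.2]
      have h3 := Finset.sum_nonneg fun i (_ : i ∈ Finset.range (N + 1)) => hnn i
      linarith
  obtain ⟨N', hN'⟩ := exists_nat_gt (4 * K / ε)
  filter_upwards [eventually_ge_atTop N', eventually_gt_atTop 0] with n hn hn0
  have hn0 : (0 : ℝ) < n := by exact_mod_cast hn0
  obtain ⟨k, hkn, hk⟩ := exists_queue_eq w n
  have hk' : (queue w n : ℝ) + digitSum w k + n = digitSum w n + k := by exact_mod_cast hk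
  have hkn' : (k : ℝ) ≤ n := by exact_mod_cast hkn
  have h1 := (abs_le.1 (hK n)).2
  have h2 := (abs_le.1 (hK k)).1
  have h3 : 4 * K < ε * n := by
    rw [div_lt_iff₀ hε] at hN'
    have : (N' : ℝ) ≤ n := by exact_mod_cast hn
    nlinarith
  have h4 : ε / 4 * k ≤ ε / 4 * n := by gcongr
  have h5 : (q - 1) * ((n : ℝ) - k) ≤ 0 :=
    mul_nonpos_of_nonpos_of_nonneg (by linarith) (by linarith)
  rw [div_lt_iff₀ hn0]
  linarith

lemma frequently_queue_eq_zero {q : ℝ} (hq : q < 1)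
    (h : Tendsto (fun n : ℕ => (busyTime w n : ℝ) / n) atTop (𝓝 q)) :
    ∃ᶠ n in atTop, queue w n = 0 := by
  by_contra hcon
  rw [not_frequently] at hcon
  obtain ⟨N, hN⟩ := eventually_atTop.1 hcon
  have hbusy : ∀ n ≥ N, busyTime w (n + 1) = busyTime w n + 1 := by
    intro n hn
    rw [busyTime_succ, if_neg]
    have := hN n hn
    omega
  have hge : ∀ k, k ≤ busyTime w (N + k) := by
    intro k
    induction k with
    | zero => exact Nat.zero_le _
    | succ k ih => rw [← add_assoc, hbusy _ (Nat.le_add_right _ _)]; omega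
  have hlim : Tendsto (fun n : ℕ => 1 - (N : ℝ) / n) atTop (𝓝 (1 - 0)) :=
    (tendsto_const_div_atTop_nhds_zero_nat (N : ℝ)).const_sub 1
  refine (le_of_tendsto_of_tendsto hlim h ?_).not_gt (by linarith)
  filter_upwards [eventually_ge_atTop N, eventually_gt_atTop 0] with n hn hn0
  have hn0 : (0 : ℝ) < n := by exact_mod_cast hn0
  obtain ⟨k, rfl⟩ := Nat.exists_eq_add_of_le hn
  have hk : (k : ℝ) ≤ busyTime w (N + k) := by exact_mod_cast hge k
  rw [le_div_iff₀ hn0, sub_mul, div_mul_cancel₀ _ hn0.ne']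
  push_cast
  linarith

lemma XF_eq_of_mem (hl : l ∈ Ioo (0 : ℝ) 1) {x : ℝ} {j k : ℕ} (hj : x ∈ XF l j)
    (hk : x ∈ Ioc (l ^ (k + 1)) (l ^ k)) : j = k := by
  have h1 : j < k + 1 := (pow_lt_pow_iff_right_of_lt_one₀ hl.1 hl.2).1 (hk.1.trans hj.2)
  have h2 : k < j + 1 := (pow_lt_pow_iff_right_of_lt_one₀ hl.1 hl.2).1 (hj.1.trans_le hk.2)
  omega

lemma Fmap_of_mem_XF_zero {x : ℝ} (hx : x ∈ XF l 0) : Fmap l x = (x - l) / (1 - l) := by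
  simp only [XF, zero_add, pow_one, pow_zero] at hx
  rw [Fmap, if_pos hx]

lemma notMem_Ioo_of_mem_XF_succ (hl : l ∈ Ioo (0 : ℝ) 1) {x : ℝ} {n : ℕ}
    (hx : x ∈ XF l (n + 1)) : x ∉ Ioo l 1 := by
  intro h
  have h0 : x ∈ XF l 0 := by simpa [XF] using h
  exact absurd (XF_eq_of_mem hl h0 (Ioo_subset_Ioc_self hx)) (by omega)

lemma Fmap_of_mem_XF_succ (hl : l ∈ Ioo (0 : ℝ) 1) {x : ℝ} {n : ℕ} (hx : x ∈ XF l (n + 1)) :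
    Fmap l x = (x - l ^ (n + 2)) / (l * (1 - l)) := by
  classical
  have h : ∃ n : ℕ, x ∈ Ioo (l ^ (n + 2)) (l ^ (n + 1)) := ⟨n, hx⟩
  rw [Fmap, if_neg (notMem_Ioo_of_mem_XF_succ hl hx), dif_pos h]
  have h1 : x ∈ XF l (Nat.find h + 1) := Nat.find_spec h
  have h2 := XF_eq_of_mem hl h1 (Ioo_subset_Ioc_self hx)
  have h3 : Nat.find h = n := by omega
  congr

lemma scaled_codePt_mem (hl : l ∈ Ioo (0 : ℝ) 1) (w : ℕ → ℕ) (k : ℕ) :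
    l ^ k * codePt l w ∈ Ioc (l ^ (k + w 0 + 1)) (l ^ (k + w 0)) := by
  have h := codePt_digit hl w
  have hp := pow_pos hl.1 k
  rw [add_assoc, pow_add, pow_add l k]
  exact ⟨mul_lt_mul_of_pos_left h.1 hp, mul_le_mul_of_nonneg_left h.2 hp.le⟩

lemma scaled_codePt_eq (hl : l ∈ Ioo (0 : ℝ) 1) (w : ℕ → ℕ) (k : ℕ) :
    l ^ k * codePt l w =
      l ^ (k + w 0 + 1) + (1 - l) * l ^ (k + w 0) * codePt l (fun i => w (1 + i)) := by
  rw [codePt_eq_one_step hl w]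
  ring

lemma scaled_codePt_mem_XF_iff (hl : l ∈ Ioo (0 : ℝ) 1) (w : ℕ → ℕ) (k : ℕ) :
    l ^ k * codePt l w ∈ XF l (k + w 0) ↔ codePt l (fun i => w (1 + i)) ≠ 1 := by
  have h := scaled_codePt_mem hl w k
  have h1 : 0 < 1 - l := by linarith [hl.2]
  have hp := pow_pos hl.1 (k + w 0)
  have h2 := (codePt_mem hl fun i => w (1 + i)).2
  constructor
  · rintro hx heq
    have h3 := hx.2
    rw [scaled_codePt_eq hl, heq, pow_succ] at h3
    linarith
  · intro hne
    refine ⟨h.1, lt_of_le_of_ne h.2 fun heq => hne ?_⟩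
    rw [scaled_codePt_eq hl, pow_succ] at heq
    have : (1 - l) * l ^ (k + w 0) * (codePt l (fun i => w (1 + i)) - 1) = 0 := by linarith
    rcases mul_eq_zero.1 this with h | h
    · exact absurd h (by positivity)
    · linarith

lemma Fmap_scaled_codePt (hl : l ∈ Ioo (0 : ℝ) 1) (w : ℕ → ℕ) (k : ℕ)
    (hw : codePt l (fun i => w (1 + i)) ≠ 1) :
    Fmap l (l ^ k * codePt l w) = l ^ (k + w 0 - 1) * codePt l (fun i => w (1 + i)) := by
  have h1 : 1 - l ≠ 0 := by linarith [hl.2]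
  have h2 : l ≠ 0 := hl.1.ne'
  have hx := (scaled_codePt_mem_XF_iff hl w k).2 hw
  have hx2 := scaled_codePt_eq hl w k
  rcases h : k + w 0 with _ | n
  · rw [h] at hx hx2
    rw [Fmap_of_mem_XF_zero hx, hx2]
    field_simp
    simp
  · rw [h] at hx hx2
    rw [Fmap_of_mem_XF_succ hl hx, hx2, Nat.add_sub_cancel]
    field_simp
    ring

lemma log_Fabsd_scaled_codePt (hl : l ∈ Ioo (0 : ℝ) 1) (w : ℕ → ℕ) (k : ℕ)
    (hw : codePt l (fun i => w (1 + i)) ≠ 1) :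
    Real.log (Fabsd l (l ^ k * codePt l w)) =
      -Real.log (1 - l) - ((if k + w 0 = 0 then 0 else 1 : ℕ) : ℝ) * Real.log l := by
  have h1 : 1 - l ≠ 0 := by linarith [hl.2]
  have hx := (scaled_codePt_mem_XF_iff hl w k).2 hw
  rcases h : k + w 0 with _ | n
  · rw [h] at hx
    simp only [XF, zero_add, pow_one, pow_zero] at hx
    rw [Fabsd, if_pos hx, one_div, Real.log_inv]
    simp
  · rw [h] at hx
    rw [Fabsd, if_neg (notMem_Ioo_of_mem_XF_succ hl hx), one_div, Real.log_inv,
      Real.log_mul hl.1.ne' h1]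
    simp
    ring

lemma shift_shift (w : ℕ → ℕ) (n : ℕ) :
    (fun i => (fun j => w (n + j)) (1 + i)) = fun i => w (n + 1 + i) := by
  funext i
  simp only [add_assoc]

lemma Fmap_iterate_codePt (hl : l ∈ Ioo (0 : ℝ) 1) (w : ℕ → ℕ) (n : ℕ)
    (hw : ∀ k < n, codePt l (fun i => w (k + 1 + i)) ≠ 1) :
    (Fmap l)^[n] (codePt l w) = l ^ queue w n * codePt l (fun i => w (n + i)) := by
  induction n with
  | zero => simp [queue]
  | succ n ih =>
    have h := hw n (Nat.lt_succ_self n)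
    rw [← shift_shift] at h
    rw [Function.iterate_succ_apply', ih fun k hk => hw k (hk.trans (Nat.lt_succ_self n)),
      Fmap_scaled_codePt hl _ _ h, shift_shift]
    rfl

lemma codePt_mem_Frepeller_iff (hl : l ∈ Ioo (0 : ℝ) 1) (w : ℕ → ℕ) :
    codePt l w ∈ Frepeller l ↔ ∀ n, codePt l (fun i => w (n + 1 + i)) ≠ 1 := by
  constructor
  · intro hx n
    induction n using Nat.strong_induction_on with
    | _ n ih =>
      obtain ⟨j, hj⟩ := mem_iUnion.1 (hx n)
      rw [Fmap_iterate_codePt hl w n ih] at hj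
      rw [XF_eq_of_mem hl hj (scaled_codePt_mem hl _ _)] at hj
      have h := (scaled_codePt_mem_XF_iff hl (fun i => w (n + i)) (queue w n)).1 hj
      rwa [shift_shift] at h
  · intro hw n
    rw [Fmap_iterate_codePt hl w n fun k _ => hw k]
    refine mem_iUnion.2 ⟨_, (scaled_codePt_mem_XF_iff hl _ _).2 ?_⟩
    rw [shift_shift]
    exact hw n

lemma birk_codePt (hl : l ∈ Ioo (0 : ℝ) 1) (hw : codePt l w ∈ Frepeller l) (n : ℕ) :
    birk (Fmap l) (fun y => Real.log (Fabsd l y)) n (codePt l w) =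
      -(n * Real.log (1 - l)) - busyTime w n * Real.log l := by
  rw [codePt_mem_Frepeller_iff hl] at hw
  induction n with
  | zero => simp [birk, busyTime]
  | succ n ih =>
    have h := hw n
    rw [← shift_shift] at h
    have hsucc : ∀ φ : ℝ → ℝ, birk (Fmap l) φ (n + 1) (codePt l w) =
        birk (Fmap l) φ n (codePt l w) + φ ((Fmap l)^[n] (codePt l w)) :=
      fun φ => Finset.sum_range_succ _ _
    rw [hsucc, ih, Fmap_iterate_codePt hl w n fun k _ => hw k,
      log_Fabsd_scaled_codePt hl _ _ h, busyTime_succ]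
    push_cast
    simp only [add_zero]
    ring

lemma codePt_mem_FJL_iff (hl : l ∈ Ioo (0 : ℝ) 1) (q : ℝ) (w : ℕ → ℕ) :
    codePt l w ∈ FJL l (-Real.log (1 - l) - q * Real.log l) ↔
      codePt l w ∈ Frepeller l ∧
        Tendsto (fun n : ℕ => (busyTime w n : ℝ) / n) atTop (𝓝 q) := by
  refine and_congr_right fun hw => ?_
  have hlog : Real.log l ≠ 0 := (Real.log_neg hl.1 hl.2).ne
  have e : (fun n : ℕ => birk (Fmap l) (fun y => Real.log (Fabsd l y)) n (codePt l w) / n)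
      =ᶠ[atTop] fun n : ℕ => -Real.log (1 - l) - (busyTime w n : ℝ) / n * Real.log l := by
    filter_upwards [eventually_gt_atTop 0] with n hn0
    have hn0 : (n : ℝ) ≠ 0 := by exact_mod_cast hn0.ne'
    rw [birk_codePt hl hw]
    field_simp
  rw [tendsto_congr' e]
  constructor
  · intro h
    have := (h.const_sub (-Real.log (1 - l))).div_const (Real.log l)
    simpa [hlog] using this
  · intro h
    exact (h.mul_const _).const_sub _

lemma codePt_mem_FJL_of_typical (hl : l ∈ Ioo (0 : ℝ) 1) {q : ℝ} (hq0 : 0 < q) (hq1 : q ≤ 1)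
    (hw : w ∈ typicalDigits q) : codePt l w ∈ FJL l (-Real.log (1 - l) - q * Real.log l) := by
  rw [codePt_mem_FJL_iff hl, codePt_mem_Frepeller_iff hl]
  have hw' : Tendsto (fun n : ℕ => (digitSum w n : ℝ) / n) atTop (𝓝 q) := hw
  constructor
  · intro n h1
    have hz := fun k => codePt_eq_one hl k h1
    have hconst : ∀ k, digitSum w (n + 1 + k) = digitSum w (n + 1) := by
      intro k
      induction k with
      | zero => rfl
      | succ k ih => rw [← add_assoc, digitSum_succ, ih, hz, add_zero]
    refine hq0.ne' (tendsto_nhds_unique hw'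
      ((tendsto_const_div_atTop_nhds_zero_nat (digitSum w (n + 1) : ℝ)).congr' ?_))
    filter_upwards [eventually_ge_atTop (n + 1)] with k hk
    obtain ⟨i, rfl⟩ := Nat.exists_eq_add_of_le hk
    rw [hconst]
  · have h := hw'.sub (tendsto_queue_div hq1 hw)
    rw [sub_zero] at h
    refine h.congr fun n => ?_
    rw [← queue_add_busyTime]
    push_cast
    ring

lemma frequently_digitSum_le {q : ℝ} (hq : q < 1)
    (h : Tendsto (fun n : ℕ => (busyTime w n : ℝ) / n) atTop (𝓝 q)) {c : ℝ} (hc : q < c) :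
    ∃ᶠ n : ℕ in atTop, digitSum w n ≤ c * (n : ℝ) := by
  refine ((frequently_queue_eq_zero hq h).and_eventually (h.eventually_lt_const hc)).mono ?_
  rintro n ⟨hn, hlt⟩
  rw [← queue_add_busyTime, hn, zero_add]
  rcases Nat.eq_zero_or_pos n with rfl | hn0
  · simp [busyTime]
  · have hn0 : (0 : ℝ) < n := by exact_mod_cast hn0
    exact ((div_lt_iff₀ hn0).1 hlt).le

lemma FJL_subset (hl : l ∈ Ioo (0 : ℝ) 1) {q : ℝ} (hq : q < 1) :
    FJL l (-Real.log (1 - l) - q * Real.log l) ⊆ {x : ℝ | ∃ w, codePt l w = x ∧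
      ∀ c > q, ∃ᶠ n : ℕ in atTop, digitSum w n ≤ c * (n : ℝ)} := by
  intro x hx
  obtain ⟨k, hk⟩ := mem_iUnion.1 (hx.1 0)
  have hk : x ∈ XF l k := hk
  obtain ⟨w, rfl⟩ := exists_codePt_eq hl
    (y := x) ⟨(pow_pos hl.1 _).trans hk.1, hk.2.le.trans (pow_le_one₀ hl.1.le hl.2.le)⟩
  rw [codePt_mem_FJL_iff hl] at hx
  exact ⟨w, rfl, fun c hc => frequently_digitSum_le hq hx.2 hc⟩

end Dynamics

end LurothCoding

open LurothCoding in
/-- **Proposition (Lyapunov spectrum, analytic part).** For `λ ∈ (1/2, 1)` and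
`t > -log 2 / log λ`, with `α_t = -log(1-λ) - λᵗ log λ/(1-λᵗ)`,
`dim_H J(α_t) = (t log(1-λ) - log(1-λᵗ))/α_t + t`. -/
theorem F_lyapunov_spectrum_formula
    (l : ℝ) (hl : l ∈ Set.Ioo (1 / 2 : ℝ) 1)
    (t : ℝ) (ht : -Real.log 2 / Real.log l < t) :
    dimH (FJL l (-Real.log (1 - l) - l ^ t * Real.log l / (1 - l ^ t))) =
      ENNReal.ofReal ((t * Real.log (1 - l) - Real.log (1 - l ^ t)) /
        (-Real.log (1 - l) - l ^ t * Real.log l / (1 - l ^ t)) + t) := by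
  have hl' : l ∈ Ioo (0 : ℝ) 1 := ⟨by linarith [hl.1], hl.2⟩
  have hl0 := hl'.1
  have h1l : 0 < 1 - l := by linarith [hl.2]
  have hlog : Real.log l < 0 := Real.log_neg hl0 hl.2
  have hlog1 : Real.log (1 - l) < 0 := Real.log_neg h1l (by linarith)
  have ht' : t * Real.log l < -Real.log 2 := (div_lt_iff_of_neg hlog).1 ht
  have ht1 : 1 < t := by
    have : Real.log (2⁻¹) < Real.log l := Real.log_lt_log (by norm_num) (by linarith [hl.1])
    rw [Real.log_inv] at this
    nlinarith
  have hm_half : l ^ t < 1 / 2 := by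
    rw [← Real.log_lt_log_iff (Real.rpow_pos_of_pos hl0 t) (by norm_num), Real.log_rpow hl0,
      one_div, Real.log_inv]
    exact ht'
  have hP : t * Real.log (1 - l) - Real.log (1 - l ^ t) < 0 := by
    have h1 : l ^ t < l := by simpa using Real.rpow_lt_rpow_of_exponent_gt hl0 hl.2 ht1
    have h2 : Real.log (1 - l) < Real.log (1 - l ^ t) := Real.log_lt_log h1l (by linarith)
    nlinarith
  have hm : l ^ t ∈ Ioo (0 : ℝ) 1 := ⟨Real.rpow_pos_of_pos hl0 t, by linarith⟩
  have hlogm : Real.log (l ^ t) = t * Real.log l := Real.log_rpow hl0 t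
  rw [mul_div_right_comm]
  set m := l ^ t with hmdef
  set q := m / (1 - m) with hqdef
  have h1m : 0 < 1 - m := by linarith [hm.2]
  have hq0 : 0 < q := div_pos hm.1 h1m
  have hq1 : q < 1 := (div_lt_one h1m).2 (by linarith)
  set α := -Real.log (1 - l) - q * Real.log l with hαdef
  have hα : 0 < α := by nlinarith
  set P := t * Real.log (1 - l) - Real.log (1 - m) with hPdef
  have hst : P / α + t < t := by linarith [div_neg_of_neg_of_pos hP hα]
  refine le_antisymm (le_of_forall_gt_imp_ge_of_dense fun b hb => ?_)
    (le_of_forall_lt_imp_le_of_dense fun a ha => ?_)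
  · obtain ⟨r, hr, hrb⟩ := ENNReal.lt_iff_exists_nnreal_btwn.1 hb
    rw [← ENNReal.ofReal_coe_nnreal, ENNReal.ofReal_lt_ofReal_iff'] at hr
    have hσ : P / α + t < min (r : ℝ) t := lt_min hr.1 hst
    have hσ' : P < (min (r : ℝ) t - t) * α := (div_lt_iff₀ hα).1 (lt_sub_iff_add_lt.2 hσ)
    refine (dimH_mono (FJL_subset hl' hq1)).trans ((dimH_frequently_le hl'
      (lt_min hr.2 (by linarith : 0 < t)) (min_le_right _ _) ?_).trans
      ((ENNReal.ofReal_le_ofReal (min_le_left _ _)).trans ?_))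
    · rw [← hmdef]
      linarith
    · rw [ENNReal.ofReal_coe_nnreal]
      exact hrb.le
  · obtain ⟨r, har, hr⟩ := ENNReal.lt_iff_exists_nnreal_btwn.1 ha
    have hr0 : (0 : ℝ) < r := by exact_mod_cast pos_of_gt har
    rw [← ENNReal.ofReal_coe_nnreal, ENNReal.ofReal_lt_ofReal_iff'] at hr
    have hσ : ((r : ℝ) - t) * α < P := (lt_div_iff₀ hα).1 (by linarith [hr.1])
    refine har.le.trans ?_
    rw [← ENNReal.ofReal_coe_nnreal]
    refine (le_dimH_image_typicalDigits hl' hm hr0 ?_).trans (dimH_mono ?_)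
    · rw [hlogm, ← hqdef]
      linarith
    · rintro _ ⟨w, hw, rfl⟩
      exact codePt_mem_FJL_of_typical hl' hq0 hq1.le hw

end
end

section
/- For the map F_λ with λ ∈ (1/2,1), the Lyapunov level set at the maximal exponent α_M = −log(λ(1−λ)) satisfies dim_H(J(−log(λ(1−λ)))) = 1. -/
open Set Filter MeasureTheory Topology

noncomputable section

/-- The points at which `F_λ` is defined and expands at the maximal rate. -/
def fastSet (l : ℝ) : Set ℝ := ⋃ m, XF l (m + 1)

/-- The points whose orbit leaves `fastSet l` within `N` steps. -/
def slowBy (l : ℝ) (N : ℕ) : Set ℝ := {x | ∃ n ≤ N, (Fmap l)^[n] x ∉ fastSet l}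

lemma slowBy_mono (l : ℝ) : Monotone (slowBy l) :=
  fun _ _ hNM _ ⟨n, hn, hx⟩ => ⟨n, hn.trans hNM, hx⟩

lemma mem_slowBy_succ {l : ℝ} {N : ℕ} {x : ℝ} (hx : x ∈ slowBy l (N + 1))
    (hx0 : x ∈ fastSet l) : Fmap l x ∈ slowBy l N := by
  obtain ⟨n, hn, h⟩ := hx
  cases n with
  | zero => exact absurd hx0 h
  | succ n => exact ⟨n, by omega, by simpa [Function.iterate_succ_apply] using h⟩

section

variable {l : ℝ}

lemma notMem_Ioo_of_mem_XF_succ (h0 : 0 < l) (h1 : l < 1) {m : ℕ} {x : ℝ}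
    (hx : x ∈ XF l (m + 1)) : x ∉ Set.Ioo l 1 := fun h => by
  have := pow_le_of_le_one h0.le h1.le (Nat.succ_ne_zero m)
  exact absurd (hx.2.trans_le this) (not_lt.mpr h.1.le)

lemma Fabsd_of_mem_fastSet (h0 : 0 < l) (h1 : l < 1) {x : ℝ} (hx : x ∈ fastSet l) :
    Fabsd l x = 1 / (l * (1 - l)) := by
  obtain ⟨m, hm⟩ := mem_iUnion.mp hx
  exact if_neg (notMem_Ioo_of_mem_XF_succ h0 h1 hm)

lemma Fmap_of_mem_XF_succ (h0 : 0 < l) (h1 : l < 1) {m : ℕ} {x : ℝ}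
    (hx : x ∈ XF l (m + 1)) : Fmap l x = (x - l ^ (m + 2)) / (l * (1 - l)) := by
  classical
  have h : ∃ n : ℕ, x ∈ Set.Ioo (l ^ (n + 2)) (l ^ (n + 1)) := ⟨m, hx⟩
  rw [Fmap, if_neg (notMem_Ioo_of_mem_XF_succ h0 h1 hx), dif_pos h]
  have key : ∀ k : ℕ, x ∈ Set.Ioo (l ^ (k + 2)) (l ^ (k + 1)) → k = m := fun k hk => by
    have a := (pow_lt_pow_iff_right_of_lt_one₀ h0 h1).mp (hk.1.trans hx.2)
    have b := (pow_lt_pow_iff_right_of_lt_one₀ h0 h1).mp (hx.1.trans hk.2)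
    omega
  rw [key _ (Nat.find_spec h)]

lemma Fmap_mem_Ioo_of_mem_XF_succ (h0 : 0 < l) (h1 : l < 1) {m : ℕ} {x : ℝ}
    (hx : x ∈ XF l (m + 1)) : Fmap l x ∈ Set.Ioo 0 (l ^ m) := by
  have hp : 0 < l * (1 - l) := mul_pos h0 (sub_pos.mpr h1)
  have hl : l ^ (m + 1 + 1) < x := hx.1
  have hu : x < l ^ (m + 1) := hx.2
  rw [Fmap_of_mem_XF_succ h0 h1 hx]
  refine ⟨div_pos (sub_pos.mpr hl) hp, (div_lt_iff₀ hp).mpr ?_⟩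
  have : l ^ m * (l * (1 - l)) = l ^ (m + 1) - l ^ (m + 2) := by ring
  linarith

lemma Ioo_zero_pow_subset (h0 : 0 < l) (h1 : l < 1) (m : ℕ) :
    Set.Ioo 0 (l ^ m) ⊆ (⋃ k, XF l (m + k)) ∪ range (fun k : ℕ => l ^ k) := by
  intro x hx
  obtain ⟨n, hn, hn'⟩ := exists_nat_pow_near_of_lt_one hx.1
    (hx.2.le.trans (pow_le_one₀ h0.le h1.le)) h0 h1
  rcases hn'.eq_or_lt with h | h
  · exact Or.inr ⟨n, h.symm⟩
  · have := (pow_lt_pow_iff_right_of_lt_one₀ h0 h1).mp (hn.trans hx.2)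
    refine Or.inl (mem_iUnion.mpr ⟨n - m, ?_⟩)
    rw [show m + (n - m) = n by omega]
    exact ⟨hn, h⟩

lemma volume_XF (m : ℕ) : volume (XF l m) = ENNReal.ofReal (l ^ m * (1 - l)) := by
  rw [XF, Real.volume_Ioo]
  congr 1
  ring

lemma volume_preimage_sub_div {a : ℝ} (ha : 0 < a) (b : ℝ) (s : Set ℝ) :
    volume ((fun x => (x - b) / a) ⁻¹' s) = ENNReal.ofReal a * volume s := by
  have : (fun x => (x - b) / a) ⁻¹' s = (fun x => x - b) ⁻¹' ((fun x => x * a⁻¹) ⁻¹' s) := rfl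
  simp only [sub_eq_add_neg] at this ⊢
  rw [this, measure_preimage_add_right, Real.volume_preimage_mul_right (inv_ne_zero ha.ne'),
    inv_inv, abs_of_pos ha]

/-- The weights `(1-λ)^(m+1)` bound the escape from `fastSet`: relative to `|X_m|` they are
the harmonic function `((1-λ)/λ)^m` of the associated random walk. -/
lemma volume_slowBy_inter_XF_le (h0 : 0 < l) (h1 : l < 1) (N m : ℕ) :
    volume (slowBy l N ∩ XF l m) ≤ ENNReal.ofReal ((1 - l) ^ (m + 1)) := by
  have hq : 0 < 1 - l := sub_pos.mpr h1
  have hzero : ∀ N, volume (slowBy l N ∩ XF l 0) ≤ ENNReal.ofReal ((1 - l) ^ (0 + 1)) :=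
    fun N => (measure_mono inter_subset_right).trans (by simp [volume_XF])
  induction N generalizing m with
  | zero =>
    cases m with
    | zero => exact hzero 0
    | succ m =>
      have : slowBy l 0 ∩ XF l (m + 1) = ∅ := by
        refine eq_empty_of_forall_notMem ?_
        rintro x ⟨⟨n, hn, h⟩, hx⟩
        obtain rfl : n = 0 := by omega
        exact h (mem_iUnion.mpr ⟨m, hx⟩)
      simp [this]
  | succ N ih =>
    cases m with
    | zero => exact hzero _
    | succ m =>
      have hsub : slowBy l (N + 1) ∩ XF l (m + 1) ⊆
          (fun x => (x - l ^ (m + 2)) / (l * (1 - l))) ⁻¹'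
            (slowBy l N ∩ Set.Ioo 0 (l ^ m)) := by
        rintro x ⟨hs, hx⟩
        rw [mem_preimage, ← Fmap_of_mem_XF_succ h0 h1 hx]
        exact ⟨mem_slowBy_succ hs (mem_iUnion.mpr ⟨m, hx⟩),
          Fmap_mem_Ioo_of_mem_XF_succ h0 h1 hx⟩
      have hcover : slowBy l N ∩ Set.Ioo 0 (l ^ m) ⊆
          (⋃ k, slowBy l N ∩ XF l (m + k)) ∪ range (fun k : ℕ => l ^ k) := by
        rintro x ⟨hs, hx⟩
        rcases Ioo_zero_pow_subset h0 h1 m hx with h | h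
        · exact Or.inl (by rw [← inter_iUnion]; exact ⟨hs, h⟩)
        · exact Or.inr h
      have hsum : HasSum (fun k : ℕ => (1 - l) ^ (m + k + 1)) ((1 - l) ^ (m + 1) * l⁻¹) := by
        have := (hasSum_geometric_of_lt_one hq.le (by linarith)).mul_left ((1 - l) ^ (m + 1))
        rw [sub_sub_cancel] at this
        refine this.congr_fun (fun k => ?_)
        ring
      calc volume (slowBy l (N + 1) ∩ XF l (m + 1))
          ≤ ENNReal.ofReal (l * (1 - l)) * volume (slowBy l N ∩ Set.Ioo 0 (l ^ m)) :=
            (measure_mono hsub).trans_eq (volume_preimage_sub_div (mul_pos h0 hq) _ _)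
        _ ≤ ENNReal.ofReal (l * (1 - l)) * ∑' k : ℕ, ENNReal.ofReal ((1 - l) ^ (m + k + 1)) := by
            gcongr
            calc volume (slowBy l N ∩ Set.Ioo 0 (l ^ m))
                ≤ volume (⋃ k, slowBy l N ∩ XF l (m + k)) + volume (range fun k : ℕ => l ^ k) :=
                  (measure_mono hcover).trans (measure_union_le _ _)
              _ = volume (⋃ k, slowBy l N ∩ XF l (m + k)) := by
                  rw [(countable_range _).measure_zero, add_zero]
              _ ≤ ∑' k, volume (slowBy l N ∩ XF l (m + k)) := measure_iUnion_le _
              _ ≤ _ := ENNReal.tsum_le_tsum fun k => ih (m + k)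
        _ = ENNReal.ofReal ((1 - l) ^ (m + 1 + 1)) := by
            rw [← ENNReal.ofReal_tsum_of_nonneg (fun k => by positivity) hsum.summable,
              hsum.tsum_eq, ← ENNReal.ofReal_mul (by positivity)]
            congr 1
            field_simp
            ring

lemma volume_XF_one_diff_slowBy_pos (h0 : 1 / 2 < l) (h1 : l < 1) :
    0 < volume (XF l 1 \ ⋃ N, slowBy l N ∩ XF l 1) := by
  have hmono : Monotone fun N => slowBy l N ∩ XF l 1 :=
    fun _ _ h => inter_subset_inter_left _ (slowBy_mono l h)
  have hle : volume (⋃ N, slowBy l N ∩ XF l 1) ≤ ENNReal.ofReal ((1 - l) ^ 2) := by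
    rw [hmono.measure_iUnion]
    exact iSup_le fun N => volume_slowBy_inter_XF_le (by linarith) h1 N 1
  refine (tsub_pos_of_lt (hle.trans_lt ?_)).trans_le le_measure_sdiff
  rw [volume_XF, ENNReal.ofReal_lt_ofReal_iff_of_nonneg (by positivity)]
  nlinarith

lemma mem_FJL_of_iterate_mem_fastSet (h0 : 0 < l) (h1 : l < 1) {x : ℝ}
    (hx : ∀ n, (Fmap l)^[n] x ∈ fastSet l) : x ∈ FJL l (-Real.log (l * (1 - l))) := by
  refine ⟨fun n => ?_, ?_⟩
  · obtain ⟨m, hm⟩ := mem_iUnion.mp (hx n)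
    exact mem_iUnion.mpr ⟨m + 1, hm⟩
  · refine tendsto_const_nhds.congr' ?_
    filter_upwards [eventually_ge_atTop 1] with n hn
    have hn' : (n : ℝ) ≠ 0 := by positivity
    simp only [birk, Fabsd_of_mem_fastSet h0 h1 (hx _), one_div, Real.log_inv,
      Finset.sum_const, Finset.card_range, nsmul_eq_mul]
    field_simp

end

lemma dimH_eq_one_of_volume_ne_zero {s : Set ℝ} (hs : volume s ≠ 0) : dimH s = 1 := by
  refine le_antisymm ((dimH_mono (subset_univ s)).trans_eq Real.dimH_univ) ?_
  have h : μH[((1 : NNReal) : ℝ)] s ≠ 0 := by simpa [hausdorffMeasure_real] using hs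
  exact_mod_cast le_dimH_of_hausdorffMeasure_ne_zero h

/-- **Proposition.** For `λ ∈ (1/2, 1)`, the Lyapunov level set at the maximal
exponent `α_M = -log(λ(1-λ))` has full Hausdorff dimension. -/
theorem F_dimH_lyapunov_level_at_max
    (l : ℝ) (hl : l ∈ Set.Ioo (1 / 2 : ℝ) 1) :
    dimH (FJL l (-Real.log (l * (1 - l)))) = 1 := by
  have h0 : 0 < l := by linarith [hl.1]
  refine dimH_eq_one_of_volume_ne_zero
    ((volume_XF_one_diff_slowBy_pos hl.1 hl.2).trans_le (measure_mono ?_)).ne'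
  rintro x ⟨hx, hs⟩
  refine mem_FJL_of_iterate_mem_fastSet h0 hl.2 fun n => ?_
  by_contra h
  exact hs (mem_iUnion.mpr ⟨n, ⟨n, le_rfl, h⟩, hx⟩)

end
end
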